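/- Let (x_n) be a sequence in ℝ² \ {0} with x_n → 0 and let r_n > 0 satisfy Σ_n r_n < ∞, with the closed balls B̄_{2r_n}(x_n) pairwise disjoint and none of them containing the origin. Set E := ∪_n B_{r_n}(x_n), ρ := χ_E + 2·χ_{ℝ²\E}, and m := ρ·L², where L² is the Lebesgue measure on ℝ². Then E is a set of finite perimeter in the metric measure space (ℝ², d_eucl, m), and the deformation property fails at the origin for E: for every R ∈ (0,1] and every C ≥ 0 there exist y ∈ B_R(0) and r ∈ (0,R) such that P(E ∪ B_r(y), B_{2R}(0)) > C·m(B_r(y) \ E)/r + P(E, B_{2R}(0)). In particular, (ℝ², d_eucl, m) does not have the deformation property. -/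

import Mathlib

open MeasureTheory Metric Set Filter Topology ENNReal Bornology
open scoped symmDiff

noncomputable section

variable {X : Type*}

/-- The slope (pointwise Lipschitz constant) of `f` at `x`, computed within `Ω`.
It vanishes at points that are isolated in `Ω`. -/
def slopeOn [MetricSpace X] (Ω : Set X) (f : X → ℝ) (x : X) : ℝ≥0∞ :=
  Filter.limsup (fun y => ENNReal.ofReal (|f x - f y| / dist x y)) (𝓝[Ω \ {x}] x)

/-- The slope of `f`. -/
def mSlope [MetricSpace X] (f : X → ℝ) (x : X) : ℝ≥0∞ := slopeOn Set.univ f x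

/-- `f` is locally Lipschitz on `Ω`. -/
def LocLipOn [MetricSpace X] (Ω : Set X) (f : X → ℝ) : Prop :=
  ∀ x ∈ Ω, ∃ r > (0:ℝ), ∃ K : NNReal, LipschitzOnWith K f (Metric.ball x r ∩ Ω)

/-- Convergence `fn → f` in `L¹_loc(Ω)` w.r.t. the measure `m`. -/
def TendstoL1loc [MetricSpace X] [MeasurableSpace X] (m : Measure X) (Ω : Set X)
    (fn : ℕ → X → ℝ) (f : X → ℝ) : Prop :=
  ∀ K : Set X, K ⊆ Ω → IsCompact K →
    Tendsto (fun n => ∫⁻ x in K, ENNReal.ofReal |fn n x - f x| ∂m) atTop (𝓝 0)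

/-- The total variation `|Df|(B)` of `f : X → ℝ` on the set `B`. -/
def totVar [MetricSpace X] [MeasurableSpace X] (m : Measure X) (f : X → ℝ) (B : Set X) : ℝ≥0∞ :=
  ⨅ (Ω : Set X) (_ : IsOpen Ω) (_ : B ⊆ Ω),
    ⨅ (fn : ℕ → X → ℝ) (_ : ∀ n, LocLipOn Ω (fn n)) (_ : TendstoL1loc m Ω fn f),
      Filter.liminf (fun n => ∫⁻ x in Ω, slopeOn Ω (fn n) x ∂m) atTop

/-- The perimeter `P(E, B)` of a set `E` in `B`. -/
def Per [MetricSpace X] [MeasurableSpace X] (m : Measure X) (E B : Set X) : ℝ≥0∞ :=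
  totVar m (Set.indicator E fun _ => (1:ℝ)) B

/-- `E` has locally finite perimeter. -/
def HasLocFinPer [MetricSpace X] [MeasurableSpace X] (m : Measure X) (E : Set X) : Prop :=
  ∀ x : X, ∃ r > (0:ℝ), Per m E (Metric.ball x r) < ∞

/-- `E` has finite perimeter. -/
def HasFinPer [MetricSpace X] [MeasurableSpace X] (m : Measure X) (E : Set X) : Prop :=
  Per m E Set.univ < ∞

/-- `m` is finite on bounded sets. -/
def BoundedlyFinite [MetricSpace X] [MeasurableSpace X] (m : Measure X) : Prop :=
  ∀ B : Set X, Bornology.IsBounded B → m B < ∞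

/-- Uniformly locally doubling with doubling function `C_D`. -/
def UnifLocDoublingWith [MetricSpace X] [MeasurableSpace X] (C_D : ℝ → ℝ) (m : Measure X) : Prop :=
  ∀ R : ℝ, 0 < R → ∀ x : X, ∀ r : ℝ, 0 < r → r < R →
    m (Metric.ball x (2 * r)) ≤ ENNReal.ofReal (C_D R) * m (Metric.ball x r)

/-- Weak local (1,1)-Poincaré inequality with dilation `lam` and constant function `C_P`. -/
def WeakPoincareWith [MetricSpace X] [MeasurableSpace X] (lam : ℝ) (C_P : ℝ → ℝ)
    (m : Measure X) : Prop :=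
  ∀ f : X → ℝ, LocLipOn Set.univ f → ∀ R : ℝ, 0 < R → ∀ x : X, ∀ r : ℝ, 0 < r → r < R →
    (∫⁻ y in Metric.ball x r,
        ENNReal.ofReal |f y - ⨍ z in Metric.ball x r, f z ∂m| ∂m) / m (Metric.ball x r)
      ≤ ENNReal.ofReal (C_P R * r) *
          ((∫⁻ y in Metric.ball x (lam * r), mSlope f y ∂m) / m (Metric.ball x (lam * r)))

/-- `(X, d, m)` is a PI space. -/
def IsPIspace [MetricSpace X] [MeasurableSpace X] (m : Measure X) : Prop :=
  (∃ C_D : ℝ → ℝ, (∀ R, 0 < R → 0 < C_D R) ∧ UnifLocDoublingWith C_D m) ∧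
  (∃ lam : ℝ, 1 ≤ lam ∧ ∃ C_P : ℝ → ℝ, (∀ R, 0 < R → 0 < C_P R) ∧ WeakPoincareWith lam C_P m)

/-- `(X, d)` is a length space: the distance between two points is the infimum of the
lengths of continuous curves joining them. -/
def IsLengthSpace (X : Type*) [MetricSpace X] : Prop :=
  ∀ p q : X, ENNReal.ofReal (dist p q) =
    ⨅ (γ : ℝ → X) (_ : ContinuousOn γ (Set.Icc 0 1)) (_ : γ 0 = p) (_ : γ 1 = q),
      eVariationOn γ (Set.Icc 0 1)

/-- Essential interior `E^{(1)}`. -/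
def essInt [MetricSpace X] [MeasurableSpace X] (m : Measure X) (E : Set X) : Set X :=
  { x | Tendsto (fun r : ℝ => m (E ∩ Metric.ball x r) / m (Metric.ball x r)) (𝓝[>] 0) (𝓝 1) }

/-- Essential exterior `E^{(0)}`. -/
def essExt [MetricSpace X] [MeasurableSpace X] (m : Measure X) (E : Set X) : Set X :=
  { x | Tendsto (fun r : ℝ => m (E ∩ Metric.ball x r) / m (Metric.ball x r)) (𝓝[>] 0) (𝓝 0) }

/-- Essential boundary `∂^e E`. -/
def essBdry [MetricSpace X] [MeasurableSpace X] (m : Measure X) (E : Set X) : Set X :=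
  (essInt m E ∪ essExt m E)ᶜ

/-- The two deformation inequalities hold for `E` at `x` with radius `R` and constant `C`. -/
def DeformIneq [MetricSpace X] [MeasurableSpace X] (m : Measure X) (E : Set X) (x : X)
    (R C : ℝ) : Prop :=
  ∀ y ∈ Metric.ball x R, ∀ r ∈ Set.Ioo (0:ℝ) R,
    Per m (E \ Metric.ball y r) (Metric.ball x (2 * R)) ≤
      ENNReal.ofReal C * m (Metric.ball y r ∩ E) / ENNReal.ofReal r +
        Per m E (Metric.ball x (2 * R)) ∧
    Per m (E ∪ Metric.ball y r) (Metric.ball x (2 * R)) ≤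
      ENNReal.ofReal C * m (Metric.ball y r \ E) / ENNReal.ofReal r +
        Per m E (Metric.ball x (2 * R))

/-- The deformation inequalities hold for `E` at `x` with radius `R` and some constant. -/
def DeformAt [MetricSpace X] [MeasurableSpace X] (m : Measure X) (E : Set X) (x : X)
    (R : ℝ) : Prop :=
  0 < R ∧ R ≤ 1 ∧ ∃ C : ℝ, 0 ≤ C ∧ DeformIneq m E x R C

/-- `R_x(E)`: the maximal radius in `(0,1]` for which the deformation inequalities hold. -/
def deformRadius [MetricSpace X] [MeasurableSpace X] (m : Measure X) (E : Set X) (x : X) : ℝ :=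
  sSup { R : ℝ | DeformAt m E x R }

/-- `(X, d, m)` has the deformation property. -/
def DeformationProperty [MetricSpace X] [MeasurableSpace X] (m : Measure X) : Prop :=
  ∀ E : Set X, MeasurableSet E → HasLocFinPer m E → ∀ x : X, ∃ R : ℝ, DeformAt m E x R

/-- `E` is a volume-constrained minimizer of the perimeter. -/
def VolConstMin [MetricSpace X] [MeasurableSpace X] (m : Measure X) (E : Set X) : Prop :=
  MeasurableSet E ∧ HasLocFinPer m E ∧
    ∀ F K : Set X, MeasurableSet F → IsCompact K →
      m ((E ∆ F) \ K) = 0 → m (E ∩ K) = m (F ∩ K) → Per m E K ≤ Per m F K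

/-- `E` is an isoperimetric set. -/
def IsIsoperimetricSet [MetricSpace X] [MeasurableSpace X] (m : Measure X) (E : Set X) : Prop :=
  MeasurableSet E ∧ HasFinPer m E ∧ 0 < m E ∧ m E < ∞ ∧
    ∀ F : Set X, MeasurableSet F → m F = m E → Per m E Set.univ ≤ Per m F Set.univ


/-! ### Limits inferior and superior in `ℝ≥0∞` -/

theorem ennreal_limsup_add_le {α : Type*} (l : Filter α) (u v : α → ℝ≥0∞) :
    limsup (fun a => u a + v a) l ≤ limsup u l + limsup v l := by
  rcases eq_or_ne (limsup u l) ∞ with hu | hu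
  · simp [hu]
  rcases eq_or_ne (limsup v l) ∞ with hv | hv
  · simp [hv]
  refine ENNReal.le_of_forall_pos_le_add fun ε hε _ => ?_
  have hε2 : (ε : ℝ≥0∞) / 2 ≠ 0 := by simp [hε.ne']
  have h1 := eventually_lt_of_limsup_lt (ENNReal.lt_add_right hu hε2)
  have h2 := eventually_lt_of_limsup_lt (ENNReal.lt_add_right hv hε2)
  refine limsup_le_of_le (by isBoundedDefault) ?_
  filter_upwards [h1, h2] with a h1 h2
  calc u a + v a ≤ (limsup u l + ε / 2) + (limsup v l + ε / 2) := add_le_add h1.le h2.le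
    _ = limsup u l + limsup v l + ε := by
      rw [add_add_add_comm, ENNReal.add_halves]

theorem ennreal_le_liminf_add (u v : ℕ → ℝ≥0∞) :
    liminf u atTop + liminf v atTop ≤ liminf (fun n => u n + v n) atTop := by
  simp only [liminf_eq_iSup_iInf_of_nat]
  rw [ENNReal.iSup_add_iSup_of_monotone]
  · refine iSup_mono fun n => le_iInf₂ fun i hi => add_le_add ?_ ?_ <;> exact iInf₂_le i hi
  all_goals
    exact fun i j hij => le_iInf₂ fun k hk => iInf₂_le k (hij.trans hk)

/-! ### Slopes -/

section Slope

variable [MetricSpace X] {Ω : Set X} {f g : X → ℝ} {x : X}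

theorem slopeOn_eq_mSlope (hΩ : IsOpen Ω) (hx : x ∈ Ω) : slopeOn Ω f x = mSlope f x := by
  have h : 𝓝[Ω \ {x}] x = 𝓝[univ \ {x}] x := by
    rw [sdiff_eq, sdiff_eq, univ_inter]
    exact nhdsWithin_inter_of_mem (mem_nhdsWithin_of_mem_nhds (hΩ.mem_nhds hx))
  rw [mSlope, slopeOn, slopeOn, h]

theorem setLIntegral_slopeOn [MeasurableSpace X] [OpensMeasurableSpace X] (m : Measure X)
    (hΩ : IsOpen Ω) : ∫⁻ x in Ω, slopeOn Ω f x ∂m = ∫⁻ x in Ω, mSlope f x ∂m :=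
  setLIntegral_congr_fun hΩ.measurableSet fun _ hx => slopeOn_eq_mSlope hΩ hx

theorem mSlope_congr (h : f =ᶠ[𝓝 x] g) : mSlope f x = mSlope g x := by
  have hx : f x = g x := h.self_of_nhds
  refine limsup_congr ?_
  filter_upwards [mem_nhdsWithin_of_mem_nhds h] with y hy
  have hy : f y = g y := hy
  rw [hx, hy]

theorem mSlope_le_of_eventually {L : ℝ} (h : ∀ᶠ y in 𝓝 x, |f x - f y| ≤ L * dist x y) :
    mSlope f x ≤ ENNReal.ofReal L := by
  refine limsup_le_of_le (by isBoundedDefault) ?_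
  filter_upwards [mem_nhdsWithin_of_mem_nhds h, self_mem_nhdsWithin] with y hy hyx
  exact ENNReal.ofReal_le_ofReal ((div_le_iff₀ (dist_pos.2 (Ne.symm hyx.2))).2 hy)

theorem mSlope_le_of_lipschitzWith {K : NNReal} (h : LipschitzWith K f) (x : X) :
    mSlope f x ≤ K := by
  rw [← ENNReal.ofReal_coe_nnreal]
  exact mSlope_le_of_eventually (.of_forall fun y => by
    simpa [Real.dist_eq] using h.dist_le_mul x y)

theorem mSlope_eq_zero_of_eventuallyEq_const {c : ℝ} (h : f =ᶠ[𝓝 x] fun _ => c) :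
    mSlope f x = 0 := by
  rw [mSlope_congr h]
  simpa using mSlope_le_of_eventually (f := fun _ : X => c) (x := x) (L := 0) (by simp)

theorem mSlope_add_le (f g : X → ℝ) (x : X) :
    mSlope (fun z => f z + g z) x ≤ mSlope f x + mSlope g x := by
  refine le_trans (limsup_le_limsup (.of_forall fun y => ?_)) (ennreal_limsup_add_le _ _ _)
  dsimp only
  rw [← ENNReal.ofReal_add (by positivity) (by positivity), ← add_div]
  refine ENNReal.ofReal_le_ofReal (div_le_div_of_nonneg_right ?_ dist_nonneg)
  rw [add_sub_add_comm]
  exact abs_add_le _ _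

theorem mSlope_sum_le {ι : Type*} (s : Finset ι) (f : ι → X → ℝ) (x : X) :
    mSlope (fun z => ∑ i ∈ s, f i z) x ≤ ∑ i ∈ s, mSlope (f i) x := by
  classical
  induction s using Finset.induction_on with
  | empty => simpa using (mSlope_eq_zero_of_eventuallyEq_const (f := fun _ : X => (0 : ℝ))
      (.rfl : (fun _ : X => (0 : ℝ)) =ᶠ[𝓝 x] fun _ => 0)).le
  | insert a s ha ih =>
    simp only [Finset.sum_insert ha]
    exact (mSlope_add_le _ _ x).trans (add_le_add le_rfl ih)

theorem mSlope_mul_le {η : X → ℝ} {K : NNReal} (hη : LipschitzWith K η)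
    (hη1 : ∀ z, |η z| ≤ 1) (g : X → ℝ) (x : X) :
    mSlope (fun z => η z * g z) x ≤ mSlope g x + ENNReal.ofReal (K * |g x|) := by
  calc mSlope (fun z => η z * g z) x
      ≤ limsup (fun y => ENNReal.ofReal (|g x - g y| / dist x y) + ENNReal.ofReal (K * |g x|))
          (𝓝[univ \ {x}] x) := by
        refine limsup_le_limsup ?_
        filter_upwards [self_mem_nhdsWithin] with y hyx
        have hd : 0 < dist x y := dist_pos.2 (Ne.symm hyx.2)
        rw [← ENNReal.ofReal_add (by positivity) (by positivity)]
        refine ENNReal.ofReal_le_ofReal ?_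
        rw [div_add' _ _ _ hd.ne']
        refine div_le_div_of_nonneg_right ?_ hd.le
        have hL : |η x - η y| ≤ K * dist x y := by
          simpa [Real.dist_eq] using hη.dist_le_mul x y
        calc |η x * g x - η y * g y| = |η y * (g x - g y) + g x * (η x - η y)| := by ring_nf
          _ ≤ |η y| * |g x - g y| + |g x| * |η x - η y| := by
            rw [← abs_mul, ← abs_mul]; exact abs_add_le _ _
          _ ≤ 1 * |g x - g y| + |g x| * (K * dist x y) := by gcongr; exact hη1 y
          _ = _ := by ring
    _ ≤ limsup (fun y => ENNReal.ofReal (|g x - g y| / dist x y)) (𝓝[univ \ {x}] x)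
          + limsup (fun _ : X => ENNReal.ofReal (K * |g x|)) (𝓝[univ \ {x}] x) :=
        ennreal_limsup_add_le _ _ _
    _ ≤ mSlope g x + ENNReal.ofReal (K * |g x|) :=
        add_le_add le_rfl (limsup_le_of_le (by isBoundedDefault) (.of_forall fun _ => le_rfl))

/-! ### Locally Lipschitz functions -/

theorem LipschitzWith.locLipOn {K : NNReal} (h : LipschitzWith K f) (Ω : Set X) : LocLipOn Ω f :=
  fun _ _ => ⟨1, one_pos, K, h.lipschitzOnWith⟩

theorem LocLipOn.mono {Ω' : Set X} (h : LocLipOn Ω f) (hΩ : Ω' ⊆ Ω) : LocLipOn Ω' f := by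
  intro x hx
  obtain ⟨r, hr, K, hK⟩ := h x (hΩ hx)
  exact ⟨r, hr, K, hK.mono (inter_subset_inter_right _ hΩ)⟩

theorem LocLipOn.add (hf : LocLipOn Ω f) (hg : LocLipOn Ω g) :
    LocLipOn Ω fun z => f z + g z := by
  intro x hx
  obtain ⟨r, hr, K, hK⟩ := hf x hx
  obtain ⟨s, hs, L, hL⟩ := hg x hx
  exact ⟨min r s, lt_min hr hs, K + L,
    (hK.mono (inter_subset_inter_left _ (ball_subset_ball (min_le_left _ _)))).add
      (hL.mono (inter_subset_inter_left _ (ball_subset_ball (min_le_right _ _))))⟩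

theorem LocLipOn.congr_nhds
    (h : ∀ x ∈ Ω, ∃ g : X → ℝ, ∃ U ∈ 𝓝 x, LocLipOn U g ∧ f =ᶠ[𝓝 x] g) : LocLipOn Ω f := by
  intro x hx
  obtain ⟨g, U, hU, hg, hfg⟩ := h x hx
  obtain ⟨r, hr, K, hK⟩ := hg x (mem_of_mem_nhds hU)
  obtain ⟨s, hs, hsU⟩ := Metric.mem_nhds_iff.1 (inter_mem hU hfg)
  refine ⟨min r s, lt_min hr hs, K, fun y hy z hz => ?_⟩
  have h1 : ∀ w ∈ ball x (min r s) ∩ Ω, w ∈ ball x r ∩ U ∧ f w = g w := fun w hw =>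
    have hw' := hsU (ball_subset_ball (min_le_right _ _) hw.1)
    ⟨⟨ball_subset_ball (min_le_left _ _) hw.1, hw'.1⟩, hw'.2⟩
  rw [(h1 y hy).2, (h1 z hz).2]
  exact hK (h1 y hy).1 (h1 z hz).1

theorem LocLipOn.continuousOn (hf : LocLipOn Ω f) : ContinuousOn f Ω := by
  intro x hx
  obtain ⟨r, hr, K, hK⟩ := hf x hx
  have := hK.continuousOn x ⟨mem_ball_self hr, hx⟩
  rwa [inter_comm, continuousWithinAt_inter (ball_mem_nhds x hr)] at this

theorem LocLipOn.mul_lipschitzWith {η : X → ℝ} {K : NNReal} (hη : LipschitzWith K η)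
    (hη1 : ∀ z, |η z| ≤ 1) (hg : LocLipOn Ω g) : LocLipOn Ω fun z => η z * g z := by
  intro x hx
  obtain ⟨r, hr, L, hL⟩ := hg x hx
  have hxr : x ∈ ball x r ∩ Ω := ⟨mem_ball_self hr, hx⟩
  refine ⟨r, hr, L + (Real.toNNReal (|g x| + L * r)) * K, LipschitzOnWith.of_dist_le_mul ?_⟩
  intro y hy z hz
  have hb : |g y| ≤ |g x| + L * r := by
    have h1 : |g y - g x| ≤ L * dist y x := by simpa [Real.dist_eq] using hL.dist_le_mul y hy x hxr
    have h2 : |g y| ≤ |g x| + |g y - g x| := by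
      have := abs_add_le (g x) (g y - g x); simpa using this
    have h3 : (L : ℝ) * dist y x ≤ L * r := by gcongr; exact (mem_ball.1 hy.1).le
    linarith
  have h1 : |g y - g z| ≤ L * dist y z := by simpa [Real.dist_eq] using hL.dist_le_mul y hy z hz
  have h2 : |η y - η z| ≤ K * dist y z := by simpa [Real.dist_eq] using hη.dist_le_mul y z
  have h0 : 0 ≤ |g x| + L * r := by positivity
  push_cast
  rw [Real.coe_toNNReal _ h0, Real.dist_eq]
  calc |η y * g y - η z * g z| = |η z * (g y - g z) + g y * (η y - η z)| := by ring_nf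
    _ ≤ |η z| * |g y - g z| + |g y| * |η y - η z| := by
      rw [← abs_mul, ← abs_mul]; exact abs_add_le _ _
    _ ≤ 1 * (L * dist y z) + (|g x| + L * r) * (K * dist y z) := by gcongr; exact hη1 z
    _ = _ := by ring

end Slope

/-! ### Perimeters -/

section Perimeter

variable [MetricSpace X] [MeasurableSpace X] {m : Measure X} {E F U B : Set X}

theorem TendstoL1loc.mono {fn : ℕ → X → ℝ} {f : X → ℝ} (h : TendstoL1loc m U fn f) (hB : B ⊆ U) :
    TendstoL1loc m B fn f :=
  fun K hK hKc => h K (hK.trans hB) hKc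

theorem Per_mono (h : B ⊆ U) : Per m E B ≤ Per m E U :=
  le_iInf₂ fun Ω hΩ => le_iInf fun hU => iInf₂_le_of_le Ω hΩ (iInf_le _ (h.trans hU))

variable [OpensMeasurableSpace X]

theorem Per_le_liminf (hU : IsOpen U) {fn : ℕ → X → ℝ} (hfn : ∀ n, LocLipOn U (fn n))
    (hlim : TendstoL1loc m U fn (E.indicator fun _ => 1)) :
    Per m E U ≤ liminf (fun n => ∫⁻ x in U, mSlope (fn n) x ∂m) atTop := by
  refine iInf₂_le_of_le U hU (iInf_le_of_le Subset.rfl (iInf₂_le_of_le fn hfn ?_))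
  refine iInf_le_of_le hlim (le_of_eq ?_)
  simp only [setLIntegral_slopeOn m hU]

theorem le_Per {c : ℝ≥0∞}
    (h : ∀ fn : ℕ → X → ℝ, (∀ n, LocLipOn U (fn n)) →
      TendstoL1loc m U fn (E.indicator fun _ => 1) →
        c ≤ liminf (fun n => ∫⁻ x in U, mSlope (fn n) x ∂m) atTop) :
    c ≤ Per m E U := by
  refine le_iInf₂ fun Ω hΩ => le_iInf fun hUΩ => le_iInf₂ fun fn hfn => le_iInf fun hlim => ?_
  refine (h fn (fun n => (hfn n).mono hUΩ) (hlim.mono hUΩ)).trans ?_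
  refine liminf_le_liminf (.of_forall fun n => ?_)
  rw [setLIntegral_slopeOn m hΩ]
  exact lintegral_mono_set hUΩ

theorem Per_le_of_inter_eq (hU : IsOpen U) (h : ∀ x ∈ U, x ∈ E ↔ x ∈ F) :
    Per m E U ≤ Per m F U := by
  refine le_Per fun fn hfn hlim => Per_le_liminf hU hfn fun K hK hKc => ?_
  refine (hlim K hK hKc).congr fun n => ?_
  refine setLIntegral_congr_fun_ae hKc.measurableSet (.of_forall fun x hx => ?_)
  have : E.indicator (fun _ => (1 : ℝ)) x = F.indicator (fun _ => 1) x := by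
    by_cases hxE : x ∈ E
    · rw [indicator_of_mem hxE, indicator_of_mem ((h x (hK hx)).1 hxE)]
    · rw [indicator_of_notMem hxE, indicator_of_notMem (mt (h x (hK hx)).2 hxE)]
  rw [this]

theorem Per_add_le_of_disjoint {V W : Set X} (hV : IsOpen V) (hW : IsOpen W) (hVU : V ⊆ U)
    (hWU : W ⊆ U) (hd : Disjoint V W) : Per m E V + Per m E W ≤ Per m E U := by
  refine le_Per fun fn hfn hlim => ?_
  refine (add_le_add (Per_le_liminf hV (fun n => (hfn n).mono hVU) (hlim.mono hVU))
    (Per_le_liminf hW (fun n => (hfn n).mono hWU) (hlim.mono hWU))).trans ?_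
  refine (ennreal_le_liminf_add _ _).trans (liminf_le_liminf (.of_forall fun n => ?_))
  rw [← lintegral_union hW.measurableSet hd]
  exact lintegral_mono_set (union_subset hVU hWU)

end Perimeter

/-! ### Lipschitz cutoffs of balls -/

/-- A Lipschitz approximation from below of the characteristic function of `ball c ρ`. -/
def ballCutoff [MetricSpace X] (c : X) (ρ : ℝ) (k : ℕ) (z : X) : ℝ :=
  max 0 (min 1 ((k + 1) * (1 - dist z c / ρ)))

section BallCutoff

variable [MetricSpace X] {c : X} {ρ : ℝ} {k : ℕ} {z : X}

theorem ballCutoff_nonneg : 0 ≤ ballCutoff c ρ k z := le_max_left _ _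

theorem ballCutoff_le_one : ballCutoff c ρ k z ≤ 1 := max_le zero_le_one (min_le_left _ _)

theorem ballCutoff_eq_zero (hρ : 0 < ρ) (h : ρ ≤ dist z c) : ballCutoff c ρ k z = 0 := by
  have h1 : 1 ≤ dist z c / ρ := (one_le_div₀ hρ).2 h
  exact max_eq_left ((min_le_right _ _).trans
    (mul_nonpos_of_nonneg_of_nonpos (by positivity) (by linarith)))

theorem ballCutoff_eq_one (h : 1 ≤ (k + 1) * (1 - dist z c / ρ)) : ballCutoff c ρ k z = 1 := by
  rw [ballCutoff, min_eq_left h, max_eq_right zero_le_one]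

theorem lipschitzWith_ballCutoff (hρ : 0 < ρ) (c : X) (k : ℕ) :
    LipschitzWith (Real.toNNReal ((k + 1) / ρ)) (ballCutoff c ρ k) := by
  have h : LipschitzWith (Real.toNNReal ((k + 1) / ρ))
      fun z => ((k : ℝ) + 1) * (1 - dist z c / ρ) := by
    refine LipschitzWith.of_dist_le_mul fun x y => ?_
    rw [Real.coe_toNNReal _ (by positivity), Real.dist_eq]
    have : ((k : ℝ) + 1) * (1 - dist x c / ρ) - (k + 1) * (1 - dist y c / ρ)
        = (k + 1) / ρ * (dist y c - dist x c) := by field_simp; ring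
    rw [this, abs_mul, abs_of_nonneg (by positivity), dist_comm x y]
    gcongr
    exact abs_dist_sub_le _ _ _
  exact (h.const_min 1).const_max 0

theorem ballCutoff_eventually_eq (hρ : 0 < ρ) (c z : X) :
    ∀ᶠ k in atTop, ballCutoff c ρ k z = (ball c ρ).indicator (fun _ => (1 : ℝ)) z := by
  by_cases hz : z ∈ ball c ρ
  · have h1 : 0 < 1 - dist z c / ρ := sub_pos.2 ((div_lt_one hρ).2 hz)
    filter_upwards [(tendsto_natCast_atTop_atTop (R := ℝ)).eventually_ge_atTop
      (1 / (1 - dist z c / ρ))] with k hk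
    rw [indicator_of_mem hz]
    refine ballCutoff_eq_one ?_
    have := (div_le_iff₀ h1).1 hk
    linarith
  · refine .of_forall fun k => ?_
    rw [indicator_of_notMem hz, ballCutoff_eq_zero hρ (not_lt.1 hz)]

/-- An upper bound for the slope of `ballCutoff`, constant on the transition annulus. -/
def ballCutoffSlope (c : X) (ρ : ℝ) (k : ℕ) : X → ℝ≥0∞ :=
  (closedBall c ρ \ ball c (ρ * (1 - 1 / (k + 1)))).indicator
    fun _ => ENNReal.ofReal ((k + 1) / ρ)

theorem measurable_ballCutoffSlope [MeasurableSpace X] [OpensMeasurableSpace X] (c : X) (ρ : ℝ)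
    (k : ℕ) : Measurable (ballCutoffSlope c ρ k) :=
  measurable_const.indicator (measurableSet_closedBall.diff measurableSet_ball)

theorem mSlope_ballCutoff_le (hρ : 0 < ρ) (c : X) (k : ℕ) (z : X) :
    mSlope (ballCutoff c ρ k) z ≤ ballCutoffSlope c ρ k z := by
  rw [ballCutoffSlope]
  by_cases hz : z ∈ closedBall c ρ \ ball c (ρ * (1 - 1 / (k + 1)))
  · rw [indicator_of_mem hz]
    exact mSlope_le_of_lipschitzWith (lipschitzWith_ballCutoff hρ c k) z
  · rw [indicator_of_notMem hz, nonpos_iff_eq_zero]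
    by_cases hz1 : z ∈ closedBall c ρ
    · have hz2 : z ∈ ball c (ρ * (1 - 1 / (k + 1))) := by
        by_contra h
        exact hz ⟨hz1, h⟩
      refine mSlope_eq_zero_of_eventuallyEq_const (c := 1) ?_
      filter_upwards [isOpen_ball.mem_nhds hz2] with y hy
      refine ballCutoff_eq_one ?_
      have h1 : dist y c / ρ < 1 - 1 / (k + 1) := by
        rw [div_lt_iff₀ hρ, mul_comm]; exact hy
      have hk : (0 : ℝ) < k + 1 := by positivity
      calc (1 : ℝ) = (k + 1) * (1 / (k + 1)) := by field_simp
        _ ≤ (k + 1) * (1 - dist y c / ρ) := by gcongr; linarith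
    · refine mSlope_eq_zero_of_eventuallyEq_const (c := 0) ?_
      filter_upwards [isClosed_closedBall.isOpen_compl.mem_nhds hz1] with y hy
      exact ballCutoff_eq_zero hρ (not_le.1 (mt mem_closedBall.2 hy)).le

end BallCutoff

section Plane

variable {m : Measure (EuclideanSpace ℝ (Fin 2))} {c : EuclideanSpace ℝ (Fin 2)} {ρ : ℝ}

theorem volume_ball_diff_closedBall {a b : ℝ} (ha : 0 ≤ a) (hab : a ≤ b)
    (c : EuclideanSpace ℝ (Fin 2)) :
    volume (ball c b \ closedBall c a) = ENNReal.ofReal (Real.pi * (b ^ 2 - a ^ 2)) := by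
  rcases hab.eq_or_lt with rfl | hab
  · simp [sdiff_eq_bot_iff.2 (show ball c a ≤ closedBall c a from ball_subset_closedBall)]
  rw [measure_sdiff (closedBall_subset_ball hab) measurableSet_closedBall.nullMeasurableSet
      measure_closedBall_lt_top.ne, EuclideanSpace.volume_ball_fin_two,
    EuclideanSpace.volume_closedBall_fin_two, ← ENNReal.ofReal_pow (ha.trans hab.le),
    ← ENNReal.ofReal_pow ha, ← ENNReal.ofReal_mul (by positivity),
    ← ENNReal.ofReal_mul (by positivity), ← ENNReal.ofReal_sub _ (by positivity)]
  ring_nf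

theorem volume_closedBall_diff_ball {a b : ℝ} (ha : 0 ≤ a) (hab : a ≤ b)
    (c : EuclideanSpace ℝ (Fin 2)) :
    volume (closedBall c b \ ball c a) = ENNReal.ofReal (Real.pi * (b ^ 2 - a ^ 2)) := by
  rw [measure_sdiff (ball_subset_closedBall.trans (closedBall_subset_closedBall hab))
      measurableSet_ball.nullMeasurableSet
      measure_ball_lt_top.ne, EuclideanSpace.volume_ball_fin_two,
    EuclideanSpace.volume_closedBall_fin_two, ← ENNReal.ofReal_pow (ha.trans hab),
    ← ENNReal.ofReal_pow ha, ← ENNReal.ofReal_mul (by positivity),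
    ← ENNReal.ofReal_mul (by positivity), ← ENNReal.ofReal_sub _ (by positivity)]
  ring_nf

theorem lintegral_ballCutoffSlope_le (hρ : 0 < ρ)
    (hm : ∀ S ⊆ closedBall c ρ, m S ≤ volume S) (k : ℕ) :
    ∫⁻ z, ballCutoffSlope c ρ k z ∂m ≤ ENNReal.ofReal (2 * Real.pi * ρ) := by
  have hk : (0 : ℝ) < k + 1 := by positivity
  have hk1 : (1 : ℝ) / (k + 1) ≤ 1 := by rw [div_le_one hk]; linarith [k.cast_nonneg (α := ℝ)]
  have hk0 : (0 : ℝ) ≤ 1 / (k + 1) := by positivity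
  calc ∫⁻ z, ballCutoffSlope c ρ k z ∂m
      = ENNReal.ofReal ((k + 1) / ρ) * m (closedBall c ρ \ ball c (ρ * (1 - 1 / (k + 1)))) :=
        lintegral_indicator_const (measurableSet_closedBall.diff measurableSet_ball) _
    _ ≤ ENNReal.ofReal ((k + 1) / ρ) *
          volume (closedBall c ρ \ ball c (ρ * (1 - 1 / (k + 1)))) :=
        mul_le_mul_right (hm _ sdiff_subset) _
    _ = ENNReal.ofReal ((k + 1) / ρ *
          (Real.pi * (ρ ^ 2 - (ρ * (1 - 1 / (k + 1))) ^ 2))) := by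
        rw [volume_closedBall_diff_ball (mul_nonneg hρ.le (by linarith))
          (mul_le_of_le_one_right hρ.le (by linarith)), ← ENNReal.ofReal_mul (by positivity)]
    _ ≤ ENNReal.ofReal (2 * Real.pi * ρ) := by
        refine ENNReal.ofReal_le_ofReal ?_
        have : ((k : ℝ) + 1) / ρ * (Real.pi * (ρ ^ 2 - (ρ * (1 - 1 / (k + 1))) ^ 2))
            = 2 * Real.pi * ρ - Real.pi * ρ * (1 / (k + 1)) := by
          field_simp
          ring
        rw [this]
        have : 0 ≤ Real.pi * ρ * (1 / (k + 1)) := by positivity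
        linarith

theorem tendsto_lintegral_abs_ballCutoff_sub [IsLocallyFiniteMeasure m] (hρ : 0 < ρ)
    {K : Set (EuclideanSpace ℝ (Fin 2))} (hK : IsCompact K) :
    Tendsto (fun k => ∫⁻ z in K,
      ENNReal.ofReal |ballCutoff c ρ k z - (ball c ρ).indicator (fun _ => (1 : ℝ)) z| ∂m)
      atTop (𝓝 0) := by
  rw [← lintegral_zero (μ := m.restrict K)]
  refine tendsto_lintegral_of_dominated_convergence (fun _ => 1) (fun k => ?_)
    (fun k => .of_forall fun z => ?_) ?_ (.of_forall fun z => ?_)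
  · exact (((lipschitzWith_ballCutoff hρ c k).continuous.measurable.sub
      (measurable_const.indicator measurableSet_ball)).abs).ennreal_ofReal
  · rw [← ENNReal.ofReal_one]
    refine ENNReal.ofReal_le_ofReal (abs_sub_le_of_nonneg_of_le ballCutoff_nonneg
      ballCutoff_le_one (indicator_nonneg (fun _ _ => zero_le_one) _) ?_)
    exact indicator_le_self' (fun _ _ => zero_le_one) _
  · simpa using hK.measure_lt_top.ne
  · refine tendsto_const_nhds.congr' ?_
    filter_upwards [ballCutoff_eventually_eq hρ c z] with k hk
    simp [hk]

end Plane

/-! ### Finite perimeter of a union of balls -/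

section Union

variable {m : Measure (EuclideanSpace ℝ (Fin 2))} [IsLocallyFiniteMeasure m]
  {x : ℕ → EuclideanSpace ℝ (Fin 2)} {ρ : ℕ → ℝ}

theorem sum_ballCutoff_of_mem (hρ : ∀ n, 0 < ρ n)
    (hd : Pairwise fun i j => Disjoint (ball (x i) (ρ i)) (ball (x j) (ρ j)))
    {z : EuclideanSpace ℝ (Fin 2)} {j : ℕ} (hz : z ∈ ball (x j) (ρ j)) (n : ℕ) :
    ∑ i ∈ Finset.range n, ballCutoff (x i) (ρ i) n z
      = if j < n then ballCutoff (x j) (ρ j) n z else 0 := by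
  have h0 : ∀ i, i ≠ j → ballCutoff (x i) (ρ i) n z = 0 := fun i hi =>
    ballCutoff_eq_zero (hρ i) (not_lt.1 fun h => disjoint_left.1 (hd hi) h hz)
  split_ifs with hj
  · exact Finset.sum_eq_single_of_mem j (Finset.mem_range.2 hj) fun i _ hi => h0 i hi
  · refine Finset.sum_eq_zero fun i hi => h0 i ?_
    rintro rfl
    exact hj (Finset.mem_range.1 hi)

theorem sum_ballCutoff_of_notMem (hρ : ∀ n, 0 < ρ n) {z : EuclideanSpace ℝ (Fin 2)}
    (hz : z ∉ ⋃ n, ball (x n) (ρ n)) (n : ℕ) :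
    ∑ i ∈ Finset.range n, ballCutoff (x i) (ρ i) n z = 0 :=
  Finset.sum_eq_zero fun i _ =>
    ballCutoff_eq_zero (hρ i) (not_lt.1 fun h => hz (mem_iUnion.2 ⟨i, h⟩))

theorem hasFinPer_iUnion_ball (hρ : ∀ n, 0 < ρ n) (hsum : Summable ρ)
    (hd : Pairwise fun i j => Disjoint (ball (x i) (ρ i)) (ball (x j) (ρ j)))
    (hm : ∀ n, ∀ S ⊆ closedBall (x n) (ρ n), m S ≤ volume S) :
    HasFinPer m (⋃ n, ball (x n) (ρ n)) := by
  set f : ℕ → EuclideanSpace ℝ (Fin 2) → ℝ :=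
    fun n z => ∑ i ∈ Finset.range n, ballCutoff (x i) (ρ i) n z with hf
  have hE : MeasurableSet (⋃ n, ball (x n) (ρ n)) :=
    MeasurableSet.iUnion fun n => measurableSet_ball
  have hcont : ∀ n, Continuous (f n) := fun n =>
    continuous_finsetSum _ fun i _ => (lipschitzWith_ballCutoff (hρ i) (x i) n).continuous
  have hlip : ∀ n, LocLipOn univ (f n) := by
    intro n
    rw [hf]
    dsimp only
    generalize Finset.range n = s
    induction s using Finset.induction_on with
    | empty => simpa using (LipschitzWith.const (0 : ℝ)).locLipOn univ
    | insert a s ha ih =>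
      simp only [Finset.sum_insert ha]
      exact ((lipschitzWith_ballCutoff (hρ a) (x a) n).locLipOn univ).add ih
  have h01 : ∀ n z, 0 ≤ f n z ∧ f n z ≤ 1 := by
    intro n z
    refine ⟨Finset.sum_nonneg fun i _ => ballCutoff_nonneg, ?_⟩
    by_cases hz : z ∈ ⋃ n, ball (x n) (ρ n)
    · obtain ⟨j, hj⟩ := mem_iUnion.1 hz
      simp only [hf, sum_ballCutoff_of_mem hρ hd hj]
      split_ifs
      exacts [ballCutoff_le_one, zero_le_one]
    · simp only [hf, sum_ballCutoff_of_notMem hρ hz, zero_le_one]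
  have hpt : ∀ z, ∀ᶠ n in atTop,
      f n z = (⋃ n, ball (x n) (ρ n)).indicator (fun _ => (1 : ℝ)) z := by
    intro z
    by_cases hz : z ∈ ⋃ n, ball (x n) (ρ n)
    · obtain ⟨j, hj⟩ := mem_iUnion.1 hz
      filter_upwards [eventually_gt_atTop j, ballCutoff_eventually_eq (hρ j) (x j) z] with n h1 h2
      simp only [hf, sum_ballCutoff_of_mem hρ hd hj, if_pos h1, h2, indicator_of_mem hj,
        indicator_of_mem hz]
    · exact .of_forall fun n => by
        simp only [hf, sum_ballCutoff_of_notMem hρ hz, indicator_of_notMem hz]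
  have hlim : TendstoL1loc m univ f ((⋃ n, ball (x n) (ρ n)).indicator fun _ => 1) := by
    intro K _ hK
    rw [← lintegral_zero (μ := m.restrict K)]
    refine tendsto_lintegral_of_dominated_convergence (fun _ => 1) (fun k => ?_)
      (fun k => .of_forall fun z => ?_) ?_ (.of_forall fun z => ?_)
    · exact (((hcont k).measurable.sub (measurable_const.indicator hE)).abs).ennreal_ofReal
    · rw [← ENNReal.ofReal_one]
      refine ENNReal.ofReal_le_ofReal (abs_sub_le_of_nonneg_of_le (h01 k z).1 (h01 k z).2
        (indicator_nonneg (fun _ _ => zero_le_one) _) ?_)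
      exact indicator_le_self' (fun _ _ => zero_le_one) _
    · simpa using hK.measure_lt_top.ne
    · refine tendsto_const_nhds.congr' ?_
      filter_upwards [hpt z] with k hk
      simp [hk]
  refine (Per_le_liminf isOpen_univ hlip hlim).trans_lt (lt_of_le_of_lt ?_
    (ENNReal.ofReal_lt_top (r := ∑' n, 2 * Real.pi * ρ n)))
  refine liminf_le_of_le (by isBoundedDefault) fun b hb => ?_
  obtain ⟨n, hn⟩ := hb.exists
  refine hn.trans ?_
  calc ∫⁻ z in univ, mSlope (f n) z ∂m
      ≤ ∫⁻ z, ∑ i ∈ Finset.range n, ballCutoffSlope (x i) (ρ i) n z ∂m := by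
        rw [setLIntegral_univ]
        exact lintegral_mono fun z => (mSlope_sum_le _ _ z).trans
          (Finset.sum_le_sum fun i _ => mSlope_ballCutoff_le (hρ i) _ _ z)
    _ = ∑ i ∈ Finset.range n, ∫⁻ z, ballCutoffSlope (x i) (ρ i) n z ∂m :=
        lintegral_finsetSum _ fun i _ => measurable_ballCutoffSlope _ _ _
    _ ≤ ∑ i ∈ Finset.range n, ENNReal.ofReal (2 * Real.pi * ρ i) :=
        Finset.sum_le_sum fun i _ => lintegral_ballCutoffSlope_le (hρ i) (hm i) n
    _ = ENNReal.ofReal (∑ i ∈ Finset.range n, 2 * Real.pi * ρ i) :=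
        (ENNReal.ofReal_sum_of_nonneg fun i _ => by have := hρ i; positivity).symm
    _ ≤ ENNReal.ofReal (∑' n, 2 * Real.pi * ρ n) :=
        ENNReal.ofReal_le_ofReal ((hsum.mul_left _).sum_le_tsum _
          fun i _ => by have := hρ i; positivity)

end Union

/-! ### Filling in a ball -/

theorem Per_le_Per_diff_closedBall_add {m : Measure (EuclideanSpace ℝ (Fin 2))}
    [IsLocallyFiniteMeasure m] {c : EuclideanSpace ℝ (Fin 2)} {ρ : ℝ} (hρ : 0 < ρ)
    {E B : Set (EuclideanSpace ℝ (Fin 2))} (hB : IsOpen B) (hcB : closedBall c (2 * ρ) ⊆ B)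
    (hE : ∀ z ∈ closedBall c (2 * ρ), z ∈ E ↔ z ∈ ball c ρ)
    (hm : ∀ S ⊆ closedBall c ρ, m S ≤ volume S) :
    Per m E B ≤ Per m E (B \ closedBall c (3 / 2 * ρ)) + ENNReal.ofReal (2 * Real.pi * ρ) := by
  set U := B \ closedBall c (3 / 2 * ρ) with hU
  have hUo : IsOpen U := hB.sdiff isClosed_closedBall
  rw [← tsub_le_iff_right]
  refine le_Per fun g hg hlim => ?_
  rw [tsub_le_iff_right]
  set η : EuclideanSpace ℝ (Fin 2) → ℝ := fun z => 1 - ballCutoff c (9 / 5 * ρ) 8 z with hη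
  obtain ⟨L, hL⟩ : ∃ L : NNReal, LipschitzWith L η :=
    ⟨_, (LipschitzWith.const (1 : ℝ)).sub (lipschitzWith_ballCutoff (by positivity) c 8)⟩
  have hη0 : ∀ z ∈ ball c (8 / 5 * ρ), η z = 0 := by
    intro z hz
    simp only [hη]
    rw [ballCutoff_eq_one, sub_self]
    have h1 : dist z c / (9 / 5 * ρ) ≤ 8 / 9 := by
      rw [div_le_iff₀ (by positivity)]
      linarith [mem_ball.1 hz]
    push_cast
    linarith
  have hη1 : ∀ z ∉ ball c (9 / 5 * ρ), η z = 1 := by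
    intro z hz
    simp only [hη]
    rw [ballCutoff_eq_zero (by positivity) (not_lt.1 hz), sub_zero]
  have hηabs : ∀ z, |η z| ≤ 1 := by
    intro z
    have h1 := ballCutoff_nonneg (c := c) (ρ := 9 / 5 * ρ) (k := 8) (z := z)
    have h2 := ballCutoff_le_one (c := c) (ρ := 9 / 5 * ρ) (k := 8) (z := z)
    simp only [hη]
    rw [abs_le]
    constructor <;> linarith
  set h : ℕ → EuclideanSpace ℝ (Fin 2) → ℝ := fun k z => η z * g k z + ballCutoff c ρ k z with hh
  have hin : ∀ k, ∀ z ∈ ball c (8 / 5 * ρ), h k z = ballCutoff c ρ k z := by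
    intro k z hz
    simp only [hh, hη0 z hz, zero_mul, zero_add]
  have hout : ∀ k, ∀ z ∉ closedBall c ρ, h k z = η z * g k z := by
    intro k z hz
    simp only [hh, ballCutoff_eq_zero hρ (not_le.1 (mt mem_closedBall.2 hz)).le, add_zero]
  have hfar : ∀ k, ∀ z ∉ closedBall c (9 / 5 * ρ), h k z = g k z := by
    intro k z hz
    rw [hout k z (fun h => hz (closedBall_subset_closedBall (by linarith) h)),
      hη1 z (fun h => hz (ball_subset_closedBall h)), one_mul]
  have hin' : ∀ k, ∀ z ∈ ball c (8 / 5 * ρ), h k =ᶠ[𝓝 z] ballCutoff c ρ k := fun k z hz =>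
    mem_of_superset (isOpen_ball.mem_nhds hz) (hin k)
  have hout' : ∀ k, ∀ z ∉ closedBall c ρ, h k =ᶠ[𝓝 z] fun z => η z * g k z := fun k z hz =>
    mem_of_superset (isClosed_closedBall.isOpen_compl.mem_nhds hz) (hout k)
  have hfar' : ∀ k, ∀ z ∉ closedBall c (9 / 5 * ρ), h k =ᶠ[𝓝 z] g k := fun k z hz =>
    mem_of_superset (isClosed_closedBall.isOpen_compl.mem_nhds hz) (hfar k)
  have hnotin : ∀ z ∉ ball c (8 / 5 * ρ), z ∉ closedBall c (3 / 2 * ρ) ∧ z ∉ closedBall c ρ := by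
    intro z hz
    simp only [mem_ball, mem_closedBall, not_lt, not_le] at hz ⊢
    constructor <;> linarith
  have hlip : ∀ k, LocLipOn B (h k) := by
    refine fun k => LocLipOn.congr_nhds fun z hz => ?_
    by_cases hz1 : z ∈ ball c (8 / 5 * ρ)
    · exact ⟨ballCutoff c ρ k, univ, univ_mem, (lipschitzWith_ballCutoff hρ c k).locLipOn univ,
        hin' k z hz1⟩
    · exact ⟨fun z => η z * g k z, U, hUo.mem_nhds ⟨hz, (hnotin z hz1).1⟩,
        (hg k).mul_lipschitzWith hL hηabs, hout' k z (hnotin z hz1).2⟩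
  have hlimh : TendstoL1loc m B h (E.indicator fun _ => 1) := by
    intro K hKB hK
    have hK' : IsCompact (K \ ball c (8 / 5 * ρ)) := hK.diff isOpen_ball
    have ht := (tendsto_lintegral_abs_ballCutoff_sub (m := m) (c := c) hρ hK).add
      (hlim (K \ ball c (8 / 5 * ρ)) (fun z hz => ⟨hKB hz.1, (hnotin z hz.2).1⟩) hK')
    rw [add_zero] at ht
    refine tendsto_of_tendsto_of_tendsto_of_le_of_le tendsto_const_nhds ht (fun _ => zero_le) ?_
    intro k
    calc ∫⁻ z in K, ENNReal.ofReal |h k z - E.indicator (fun _ => 1) z| ∂m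
        ≤ ∫⁻ z in (K ∩ ball c (8 / 5 * ρ)) ∪ (K \ ball c (8 / 5 * ρ)),
            ENNReal.ofReal |h k z - E.indicator (fun _ => 1) z| ∂m := by
          rw [inter_union_sdiff]
      _ ≤ _ := lintegral_union_le _ _ _
      _ ≤ _ := by
          refine add_le_add ?_ ?_
          · refine (setLIntegral_mono' (hK.measurableSet.inter measurableSet_ball) ?_).trans
              (lintegral_mono_set inter_subset_left)
            intro z hz
            have hzE := hE z (ball_subset_closedBall (ball_subset_ball (by linarith) hz.2))
            rw [hin k z hz.2]
            by_cases hzc : z ∈ ball c ρ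
            · rw [indicator_of_mem hzc, indicator_of_mem (hzE.2 hzc)]
            · rw [indicator_of_notMem hzc, indicator_of_notMem (mt hzE.1 hzc)]
          · refine setLIntegral_mono' hK'.measurableSet fun z hz => ENNReal.ofReal_le_ofReal ?_
            rw [hout k z (hnotin z hz.2).2]
            by_cases hz9 : z ∈ ball c (9 / 5 * ρ)
            · have hzE : z ∉ E := fun hzE => (hnotin z hz.2).2 (ball_subset_closedBall
                ((hE z (ball_subset_closedBall (ball_subset_ball (by linarith) hz9))).1 hzE))
              rw [indicator_of_notMem hzE, sub_zero, sub_zero, abs_mul]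
              exact mul_le_of_le_one_left (abs_nonneg _) (hηabs z)
            · rw [hη1 z hz9, one_mul]
  set K := closedBall c (9 / 5 * ρ) \ ball c (8 / 5 * ρ) with hKdef
  set W := B \ closedBall c (9 / 5 * ρ) with hW
  have hKc : IsCompact K := (isCompact_closedBall c _).diff isOpen_ball
  have hKU : K ⊆ U := fun z hz =>
    ⟨hcB (closedBall_subset_closedBall (by linarith) hz.1), (hnotin z hz.2).1⟩
  have hWU : W ⊆ U := sdiff_subset_sdiff_right (closedBall_subset_closedBall (by linarith))
  have hWm : MeasurableSet W := (hB.sdiff isClosed_closedBall).measurableSet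
  have hKW : Disjoint K W := disjoint_left.2 fun z hz hz' => hz'.2 hz.1
  have hcover : B ⊆ ball c (8 / 5 * ρ) ∪ (K ∪ W) := by
    intro z hz
    by_cases h1 : z ∈ ball c (8 / 5 * ρ)
    · exact .inl h1
    by_cases h2 : z ∈ closedBall c (9 / 5 * ρ)
    · exact .inr (.inl ⟨h2, h1⟩)
    · exact .inr (.inr ⟨hz, h2⟩)
  have hε : Tendsto (fun k => ∫⁻ z in K, ENNReal.ofReal (L * |g k z|) ∂m) atTop (𝓝 0) := by
    have := ENNReal.Tendsto.const_mul (a := ENNReal.ofReal L) (hlim K hKU hKc)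
      (.inr ENNReal.ofReal_ne_top)
    rw [mul_zero] at this
    refine this.congr fun k => ?_
    rw [← lintegral_const_mul' _ _ ENNReal.ofReal_ne_top]
    refine setLIntegral_congr_fun hKc.measurableSet fun z hz => ?_
    have hzE : z ∉ E := fun hzE => (hnotin z hz.2).2 (ball_subset_closedBall
      ((hE z (closedBall_subset_closedBall (by linarith) hz.1)).1 hzE))
    rw [indicator_of_notMem hzE, sub_zero, ENNReal.ofReal_mul L.coe_nonneg]
  have henergy : ∀ k, ∫⁻ z in B, mSlope (h k) z ∂m ≤
      ∫⁻ z in U, mSlope (g k) z ∂m + ENNReal.ofReal (2 * Real.pi * ρ)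
        + ∫⁻ z in K, ENNReal.ofReal (L * |g k z|) ∂m := by
    intro k
    have h1 : ∫⁻ z in ball c (8 / 5 * ρ), mSlope (h k) z ∂m ≤ ENNReal.ofReal (2 * Real.pi * ρ) := by
      refine le_trans (le_trans (setLIntegral_mono' measurableSet_ball fun z hz => ?_)
        (setLIntegral_le_lintegral _ _)) (lintegral_ballCutoffSlope_le hρ hm k)
      rw [mSlope_congr (hin' k z hz)]
      exact mSlope_ballCutoff_le hρ c k z
    have h2 : ∫⁻ z in K, mSlope (h k) z ∂m ≤
        ∫⁻ z in K, mSlope (g k) z ∂m + ∫⁻ z in K, ENNReal.ofReal (L * |g k z|) ∂m := by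
      have hgm : AEMeasurable (fun z => ENNReal.ofReal (L * |g k z|)) (m.restrict K) :=
        ((((hg k).continuousOn.mono hKU).aemeasurable hKc.measurableSet).norm.const_mul
          (L : ℝ)).ennreal_ofReal
      rw [← lintegral_add_right' _ hgm]
      refine setLIntegral_mono' hKc.measurableSet fun z hz => ?_
      rw [mSlope_congr (hout' k z (hnotin z hz.2).2)]
      exact mSlope_mul_le hL hηabs (g k) z
    have h3 : ∫⁻ z in W, mSlope (h k) z ∂m = ∫⁻ z in W, mSlope (g k) z ∂m :=
      setLIntegral_congr_fun hWm fun z hz => mSlope_congr (hfar' k z hz.2)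
    calc ∫⁻ z in B, mSlope (h k) z ∂m
        ≤ ∫⁻ z in ball c (8 / 5 * ρ) ∪ (K ∪ W), mSlope (h k) z ∂m := lintegral_mono_set hcover
      _ ≤ ∫⁻ z in ball c (8 / 5 * ρ), mSlope (h k) z ∂m +
          (∫⁻ z in K, mSlope (h k) z ∂m + ∫⁻ z in W, mSlope (h k) z ∂m) :=
        (lintegral_union_le _ _ _).trans (add_le_add le_rfl (lintegral_union_le _ _ _))
      _ ≤ ENNReal.ofReal (2 * Real.pi * ρ) +
          ((∫⁻ z in K, mSlope (g k) z ∂m + ∫⁻ z in K, ENNReal.ofReal (L * |g k z|) ∂m)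
            + ∫⁻ z in W, mSlope (g k) z ∂m) := by
        rw [h3]
        exact add_le_add h1 (add_le_add h2 le_rfl)
      _ = ∫⁻ z in K ∪ W, mSlope (g k) z ∂m + ENNReal.ofReal (2 * Real.pi * ρ)
            + ∫⁻ z in K, ENNReal.ofReal (L * |g k z|) ∂m := by
        rw [lintegral_union hWm hKW]
        ring
      _ ≤ _ := by
        gcongr
        exact union_subset hKU hWU
  calc Per m E B ≤ liminf (fun k => ∫⁻ z in B, mSlope (h k) z ∂m) atTop :=
        Per_le_liminf hB hlip hlimh
    _ ≤ liminf ((fun k => ∫⁻ z in U, mSlope (g k) z ∂m + ENNReal.ofReal (2 * Real.pi * ρ)) +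
          fun k => ∫⁻ z in K, ENNReal.ofReal (L * |g k z|) ∂m) atTop :=
        liminf_le_liminf (.of_forall henergy)
    _ = liminf (fun k => ∫⁻ z in U, mSlope (g k) z ∂m + ENNReal.ofReal (2 * Real.pi * ρ)) atTop :=
        ENNReal.liminf_add_of_right_tendsto_zero hε _
    _ = liminf (fun k => ∫⁻ z in U, mSlope (g k) z ∂m) atTop
          + ENNReal.ofReal (2 * Real.pi * ρ) :=
        liminf_add_const atTop _ _ (by isBoundedDefault) (by isBoundedDefault)

/-! ### A lower bound for the perimeter of a ball via radial variation -/

section Radial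

theorem lintegral_comp_smul_le {t : ℝ} (ht : 1 ≤ t) {h : EuclideanSpace ℝ (Fin 2) → ℝ≥0∞}
    (hh : Measurable h) : ∫⁻ v, h (t • v) ≤ ∫⁻ v, h v := by
  have h0 : t ≠ 0 := by positivity
  rw [← lintegral_map hh (measurable_const_smul t), Measure.map_addHaar_smul _ h0,
    lintegral_smul_measure, smul_eq_mul]
  refine mul_le_of_le_one_left' (ENNReal.ofReal_le_one.2 ?_)
  rw [abs_of_nonneg (by positivity)]
  exact inv_le_one_of_one_le₀ (one_le_pow₀ ht)

/-- The upper radial difference quotient of `F` at `v`, multiplied by `‖v‖`. -/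
def radialSlope (F : EuclideanSpace ℝ (Fin 2) → ℝ) (v : EuclideanSpace ℝ (Fin 2)) : ℝ≥0∞ :=
  limsup (fun n : ℕ =>
    ENNReal.ofReal ((n + 1) * |F (v + (1 / ((n : ℝ) + 1)) • v) - F v|)) atTop

theorem measurable_radialSlope {F : EuclideanSpace ℝ (Fin 2) → ℝ} (hF : Measurable F) :
    Measurable (radialSlope F) := by
  refine Measurable.limsup fun n => ENNReal.measurable_ofReal.comp ?_
  have h : Measurable fun v : EuclideanSpace ℝ (Fin 2) => F (v + (1 / ((n : ℝ) + 1)) • v) :=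
    hF.comp (measurable_id.add (measurable_const_smul _))
  exact measurable_const.mul (continuous_abs.measurable.comp (h.sub hF))

theorem radialSlope_le {c : EuclideanSpace ℝ (Fin 2)} {Ω : Set (EuclideanSpace ℝ (Fin 2))}
    (hΩ : IsOpen Ω) {f F : EuclideanSpace ℝ (Fin 2) → ℝ} (hF : ∀ v, c + v ∈ Ω → F v = f (c + v))
    {v : EuclideanSpace ℝ (Fin 2)} (hv : c + v ∈ Ω) (hv0 : v ≠ 0) :
    radialSlope F v ≤ ENNReal.ofReal ‖v‖ * mSlope f (c + v) := by
  have hnv : 0 < ‖v‖ := norm_pos_iff.2 hv0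
  have hlim : Tendsto (fun n : ℕ => v + (1 / ((n : ℝ) + 1)) • v) atTop (𝓝 v) := by
    simpa using (tendsto_const_nhds (x := v)).add
      ((tendsto_one_div_add_atTop_nhds_zero_nat (𝕜 := ℝ)).smul_const v)
  have hy : Tendsto (fun n : ℕ => c + (v + (1 / ((n : ℝ) + 1)) • v)) atTop
      (𝓝[univ \ {c + v}] (c + v)) := by
    refine tendsto_nhdsWithin_iff.2 ⟨hlim.const_add c, .of_forall fun n => ⟨mem_univ _, ?_⟩⟩
    have : (1 / ((n : ℝ) + 1)) ≠ 0 := by positivity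
    simp [hv0, Nat.cast_add_one_ne_zero]
  have hyΩ := hy.eventually (mem_nhdsWithin_of_mem_nhds (hΩ.mem_nhds hv))
  set y : ℕ → EuclideanSpace ℝ (Fin 2) := fun n => c + (v + (1 / ((n : ℝ) + 1)) • v) with hydef
  set q : EuclideanSpace ℝ (Fin 2) → ℝ≥0∞ :=
    fun z => ENNReal.ofReal (|f (c + v) - f z| / dist (c + v) z) with hq
  have hle : limsup (fun n => q (y n)) atTop ≤ mSlope f (c + v) := by
    change limsup q (map y atTop) ≤ limsup q (𝓝[univ \ {c + v}] (c + v))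
    exact limsup_le_limsup_of_le hy
  have heq : radialSlope F v = limsup (fun n => ENNReal.ofReal ‖v‖ * q (y n)) atTop := by
    refine limsup_congr ?_
    filter_upwards [hyΩ] with n hn
    have hd : dist (c + v) (c + (v + (1 / ((n : ℝ) + 1)) • v)) = ‖v‖ / (n + 1) := by
      rw [dist_add_left, dist_self_add_right, norm_smul, Real.norm_of_nonneg (by positivity)]
      ring
    simp only [hq, hydef]
    rw [← ENNReal.ofReal_mul (norm_nonneg v), hd, hF _ hv, hF _ hn, abs_sub_comm]
    congr 1
    field_simp
  rw [heq, ENNReal.limsup_const_mul_of_ne_top ENNReal.ofReal_ne_top]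
  exact mul_le_mul_right hle _

theorem ofReal_abs_sub_le_lintegral_radialSlope {F : EuclideanSpace ℝ (Fin 2) → ℝ} {l : ℝ}
    (hl : 1 ≤ l) {v : EuclideanSpace ℝ (Fin 2)} {K : NNReal}
    (hF : LipschitzOnWith K (fun t : ℝ => F (t • v)) (Icc 1 l)) :
    ENNReal.ofReal |F v - F (l • v)| ≤ ∫⁻ t in Icc 1 l, radialSlope F (t • v) := by
  set g : ℝ → ℝ := fun t => F (t • v) with hg
  have hac : AbsolutelyContinuousOnInterval g 1 l :=
    LipschitzOnWith.absolutelyContinuousOnInterval (by rwa [uIcc_of_le hl])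
  have hFTC := hac.integral_deriv_eq_sub
  rw [intervalIntegral.integral_of_le hl] at hFTC
  calc ENNReal.ofReal |F v - F (l • v)| = ‖∫ t in Ioc 1 l, deriv g t‖ₑ := by
        rw [hFTC, ← ofReal_norm, Real.norm_eq_abs, abs_sub_comm]
        simp [hg]
    _ ≤ ∫⁻ t in Ioc 1 l, ‖deriv g t‖ₑ := enorm_integral_le_lintegral_enorm _
    _ ≤ ∫⁻ t in Ioc 1 l, radialSlope F (t • v) := by
        refine setLIntegral_mono_ae' measurableSet_Ioc ?_
        filter_upwards [hac.ae_differentiableAt] with t ht htI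
        rw [uIcc_of_le hl] at ht
        have hd := (ht (Ioc_subset_Icc_self htI)).hasDerivAt
        have ht0 : 0 < t := one_pos.trans htI.1
        have hy : Tendsto (fun n : ℕ => t + 1 / ((n : ℝ) + 1) * t) atTop (𝓝[≠] t) := by
          refine tendsto_nhdsWithin_iff.2 ⟨?_, .of_forall fun n => ?_⟩
          · simpa using (tendsto_const_nhds (x := t)).add
              ((tendsto_one_div_add_atTop_nhds_zero_nat (𝕜 := ℝ)).mul_const t)
          · have : 0 < 1 / ((n : ℝ) + 1) * t := by positivity
            simp only [mem_compl_iff, mem_singleton_iff]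
            linarith
        have hlim := (((hasDerivAt_iff_tendsto_slope.1 hd).comp hy).abs.const_mul t)
        have hlim' : Tendsto (fun n : ℕ => ENNReal.ofReal
            ((n + 1) * |F (t • v + (1 / ((n : ℝ) + 1)) • (t • v)) - F (t • v)|)) atTop
            (𝓝 (ENNReal.ofReal (t * |deriv g t|))) := by
          refine (ENNReal.continuous_ofReal.tendsto _).comp (hlim.congr fun n => ?_)
          have hn : (0 : ℝ) < n + 1 := by positivity
          have h1 : t • v + (1 / ((n : ℝ) + 1)) • (t • v) = (t + 1 / ((n : ℝ) + 1) * t) • v := by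
            rw [smul_smul, add_smul]
          rw [h1, Function.comp_apply, slope_def_field, abs_div, add_sub_cancel_left,
            abs_of_pos (show 0 < 1 / ((n : ℝ) + 1) * t by positivity)]
          field_simp
          rfl
        rw [radialSlope, hlim'.limsup_eq, ← ofReal_norm, Real.norm_eq_abs]
        exact ENNReal.ofReal_le_ofReal (le_mul_of_one_le_left (abs_nonneg _) htI.1.le)
    _ ≤ ∫⁻ t in Icc 1 l, radialSlope F (t • v) := lintegral_mono_set Ioc_subset_Icc_self

theorem lintegral_annulus_radial_le {D : EuclideanSpace ℝ (Fin 2) → ℝ≥0∞} (hD : Measurable D)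
    {a b l : ℝ} (ha : 0 < a) (hab : a < b) :
    ∫⁻ v in ball 0 b \ closedBall 0 a, ∫⁻ t in Icc 1 l, D (t • v) ≤
      ∫⁻ z in ball 0 (l * b) \ closedBall 0 a, ENNReal.ofReal (‖z‖ * (1 / a - 1 / b)) * D z := by
  set A : Set (EuclideanSpace ℝ (Fin 2)) := ball 0 b \ closedBall 0 a with hA
  set T : Set (EuclideanSpace ℝ (Fin 2)) := ball 0 (l * b) \ closedBall 0 a with hT
  have hAm : MeasurableSet A := measurableSet_ball.diff measurableSet_closedBall
  have hTm : MeasurableSet T := measurableSet_ball.diff measurableSet_closedBall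
  have hχ : Measurable (A.indicator fun _ => (1 : ℝ≥0∞)) := measurable_const.indicator hAm
  calc ∫⁻ v in A, ∫⁻ t in Icc 1 l, D (t • v)
      = ∫⁻ t in Icc 1 l, ∫⁻ v in A, D (t • v) :=
        lintegral_lintegral_swap (hD.comp (measurable_snd.smul measurable_fst)).aemeasurable
    _ ≤ ∫⁻ t in Icc 1 l, ∫⁻ z, A.indicator (fun _ => 1) (t⁻¹ • z) * D z := by
        refine setLIntegral_mono' measurableSet_Icc fun t ht => ?_
        have ht0 : t ≠ 0 := (one_pos.trans_le ht.1).ne'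
        refine le_trans (le_of_eq ?_) (lintegral_comp_smul_le ht.1
          ((hχ.comp (measurable_const_smul t⁻¹)).mul hD))
        rw [← lintegral_indicator hAm]
        refine lintegral_congr fun v => ?_
        by_cases hv : v ∈ A <;> simp [hv, smul_smul, ht0]
    _ = ∫⁻ z, ∫⁻ t in Icc 1 l, A.indicator (fun _ => 1) (t⁻¹ • z) * D z :=
        lintegral_lintegral_swap ((hχ.comp (measurable_fst.inv.smul measurable_snd)).mul
          (hD.comp measurable_snd)).aemeasurable
    _ ≤ ∫⁻ z, T.indicator (fun z => ENNReal.ofReal (‖z‖ * (1 / a - 1 / b)) * D z) z := by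
        refine lintegral_mono fun z => ?_
        dsimp only
        have hmem : ∀ t ∈ Icc 1 l, t⁻¹ • z ∈ A → a * t < ‖z‖ ∧ ‖z‖ < b * t := by
          intro t ht hz
          have ht0 : 0 < t := one_pos.trans_le ht.1
          simp only [hA, Set.mem_sdiff, mem_ball_zero_iff, mem_closedBall_zero_iff, not_le, norm_smul,
            norm_inv, Real.norm_of_nonneg ht0.le, inv_mul_eq_div] at hz
          exact ⟨(lt_div_iff₀ ht0).1 hz.2, (div_lt_iff₀ ht0).1 hz.1⟩
        by_cases hzT : z ∈ T
        · have hm' : Measurable fun t : ℝ => A.indicator (fun _ => (1 : ℝ≥0∞)) (t⁻¹ • z) :=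
            hχ.comp (measurable_id.inv.smul measurable_const)
          rw [indicator_of_mem hzT, lintegral_mul_const _ hm']
          refine mul_le_mul_left ?_ _
          calc ∫⁻ t in Icc 1 l, A.indicator (fun _ => 1) (t⁻¹ • z)
              ≤ ∫⁻ t in Icc 1 l, (Ioo (‖z‖ / b) (‖z‖ / a)).indicator (fun _ => 1) t := by
                refine setLIntegral_mono' measurableSet_Icc fun t ht => ?_
                by_cases hz : t⁻¹ • z ∈ A
                · have := hmem t ht hz
                  rw [indicator_of_mem hz, indicator_of_mem]
                  constructor
                  · rw [div_lt_iff₀ (ha.trans hab)]; linarith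
                  · rw [lt_div_iff₀ ha]; linarith
                · rw [indicator_of_notMem hz]
                  exact zero_le
            _ ≤ ∫⁻ t, (Ioo (‖z‖ / b) (‖z‖ / a)).indicator (fun _ => 1) t :=
                setLIntegral_le_lintegral _ _
            _ = ENNReal.ofReal (‖z‖ * (1 / a - 1 / b)) := by
                rw [lintegral_indicator_const measurableSet_Ioo, one_mul, Real.volume_Ioo]
                ring_nf
        · rw [indicator_of_notMem hzT]
          refine (setLIntegral_eq_zero measurableSet_Icc fun t ht => ?_).le
          rw [indicator_of_notMem, zero_mul, Pi.zero_apply]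
          intro hz
          have := hmem t ht hz
          refine hzT ⟨?_, ?_⟩
          · rw [mem_ball_zero_iff]
            nlinarith [ht.2]
          · rw [mem_closedBall_zero_iff, not_le]
            nlinarith [ht.1]
    _ = _ := lintegral_indicator hTm _

theorem lintegral_annulus_abs_sub_le {c : EuclideanSpace ℝ (Fin 2)} {a b l s : ℝ} (ha : 0 < a)
    (hab : a < b) (hl : 1 ≤ l) (hs : l * b < s) {f F : EuclideanSpace ℝ (Fin 2) → ℝ}
    (hf : LocLipOn (ball c s) f) (hFm : Measurable F) (hF : ∀ v, c + v ∈ ball c s → F v = f (c + v)) :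
    ∫⁻ v in ball 0 b \ closedBall 0 a, ENNReal.ofReal |F v - F (l • v)| ≤
      ENNReal.ofReal ((l * b) ^ 2 * (1 / a - 1 / b)) *
        ∫⁻ z in ball c (l * b) \ closedBall c a, mSlope f z := by
  have hab' : 0 ≤ 1 / a - 1 / b := sub_nonneg.2 (one_div_le_one_div_of_le ha hab.le)
  calc ∫⁻ v in ball 0 b \ closedBall 0 a, ENNReal.ofReal |F v - F (l • v)|
      ≤ ∫⁻ v in ball 0 b \ closedBall 0 a, ∫⁻ t in Icc 1 l, radialSlope F (t • v) := by
        refine setLIntegral_mono' (measurableSet_ball.diff measurableSet_closedBall) fun v hv => ?_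
        have hmem : ∀ t ∈ Icc 1 l, c + t • v ∈ ball c s := by
          intro t ht
          have hvb : ‖v‖ < b := mem_ball_zero_iff.1 hv.1
          rw [mem_ball, dist_self_add_left, norm_smul,
            Real.norm_of_nonneg (zero_le_one.trans ht.1)]
          nlinarith [ht.1, ht.2, norm_nonneg v]
        have hloc : LocallyLipschitzOn (Icc 1 l) fun t : ℝ => f (c + t • v) := by
          intro t ht
          obtain ⟨r, hr, K, hK⟩ := hf _ (hmem t ht)
          have hline : LipschitzWith ‖v‖₊ fun t : ℝ => c + t • v := by
            refine LipschitzWith.of_dist_le_mul fun x y => ?_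
            rw [dist_add_left, dist_eq_norm, ← sub_smul, norm_smul, mul_comm, Real.dist_eq,
              Real.norm_eq_abs, coe_nnnorm]
          have hpre : (fun t : ℝ => c + t • v) ⁻¹' (ball (c + t • v) r ∩ ball c s) ∈ 𝓝 t :=
            hline.continuous.continuousAt (inter_mem (ball_mem_nhds _ hr)
              (isOpen_ball.mem_nhds (hmem t ht)))
          exact ⟨K * ‖v‖₊, _, mem_nhdsWithin_of_mem_nhds hpre,
            hK.comp hline.lipschitzOnWith (mapsTo_preimage _ _)⟩
        obtain ⟨K, hK⟩ := hloc.exists_lipschitzOnWith_of_compact isCompact_Icc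
        refine ofReal_abs_sub_le_lintegral_radialSlope hl (K := K) fun x hx y hy => ?_
        dsimp only
        rw [hF _ (hmem x hx), hF _ (hmem y hy)]
        exact hK hx hy
    _ ≤ ∫⁻ z in ball 0 (l * b) \ closedBall 0 a,
          ENNReal.ofReal (‖z‖ * (1 / a - 1 / b)) * radialSlope F z :=
        lintegral_annulus_radial_le (measurable_radialSlope hFm) ha hab
    _ ≤ ∫⁻ z in ball 0 (l * b) \ closedBall 0 a,
          ENNReal.ofReal ((l * b) ^ 2 * (1 / a - 1 / b)) * mSlope f (c + z) := by
        refine setLIntegral_mono' (measurableSet_ball.diff measurableSet_closedBall) fun z hz => ?_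
        have hz1 : ‖z‖ < l * b := mem_ball_zero_iff.1 hz.1
        have hz2 : a < ‖z‖ := not_le.1 (mt mem_closedBall_zero_iff.2 hz.2)
        have hzs : c + z ∈ ball c s := by
          rw [mem_ball, dist_self_add_left]; exact hz1.trans hs
        calc _ ≤ ENNReal.ofReal (‖z‖ * (1 / a - 1 / b)) *
                (ENNReal.ofReal ‖z‖ * mSlope f (c + z)) :=
              mul_le_mul_right (radialSlope_le isOpen_ball hF hzs
                (norm_pos_iff.1 (ha.trans hz2))) _
          _ ≤ _ := by
              rw [← mul_assoc, ← ENNReal.ofReal_mul (by positivity)]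
              refine mul_le_mul_left (ENNReal.ofReal_le_ofReal ?_) _
              calc ‖z‖ * (1 / a - 1 / b) * ‖z‖ = ‖z‖ ^ 2 * (1 / a - 1 / b) := by ring
                _ ≤ _ := by gcongr
    _ = ENNReal.ofReal ((l * b) ^ 2 * (1 / a - 1 / b)) *
          ∫⁻ z in ball 0 (l * b) \ closedBall 0 a, mSlope f (c + z) :=
        lintegral_const_mul' _ _ ENNReal.ofReal_ne_top
    _ = _ := by
        have hpre : (fun z => c + z) ⁻¹' (ball c (l * b) \ closedBall c a)
            = ball 0 (l * b) \ closedBall 0 a := by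
          ext z; simp
        rw [← hpre, (measurePreserving_add_left volume c).setLIntegral_comp_preimage_emb
          (measurableEmbedding_addLeft c)]

end Radial

/-! ### A lower bound for the perimeter of an enlarged ball -/

section Enlarged

theorem volume_annulus_le {c : EuclideanSpace ℝ (Fin 2)} {ρ r l s : ℝ} (hρ : 0 < ρ) (hr : ρ < r)
    (hl : 1 ≤ l) (hlρ : r ≤ l * ρ) (hs : l * r < s) {f : EuclideanSpace ℝ (Fin 2) → ℝ}
    (hf : LocLipOn (ball c s) f) :
    volume (ball (0 : EuclideanSpace ℝ (Fin 2)) r \ closedBall 0 ρ) ≤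
      ENNReal.ofReal ((l * r) ^ 2 * (1 / ρ - 1 / r)) *
          (∫⁻ z in ball c (l * r) \ closedBall c ρ, mSlope f z) +
        2 * ∫⁻ z in closedBall c (l * r) \ closedBall c ρ,
          ENNReal.ofReal |f z - (ball c r).indicator (fun _ => 1) z| := by
  classical
  set A : Set (EuclideanSpace ℝ (Fin 2)) := ball 0 r \ closedBall 0 ρ with hA
  set S : Set (EuclideanSpace ℝ (Fin 2)) := closedBall c (l * r) \ closedBall c ρ with hS
  have hAm : MeasurableSet A := measurableSet_ball.diff measurableSet_closedBall
  have hSm : MeasurableSet S := measurableSet_closedBall.diff measurableSet_closedBall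
  have hSs : S ⊆ ball c s := fun z hz => closedBall_subset_ball hs hz.1
  have hfm : Measurable ((ball c s).indicator f) := by
    rw [← piecewise_eq_indicator]
    exact hf.continuousOn.measurable_piecewise continuousOn_const measurableSet_ball
  set H : EuclideanSpace ℝ (Fin 2) → ℝ≥0∞ := S.indicator fun z =>
    ENNReal.ofReal |(ball c s).indicator f z - (ball c r).indicator (fun _ => 1) z| with hH
  have hHm : Measurable H := by
    refine Measurable.indicator (ENNReal.measurable_ofReal.comp
      (continuous_abs.measurable.comp (hfm.sub ?_))) hSm
    exact measurable_const.indicator measurableSet_ball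
  set F : EuclideanSpace ℝ (Fin 2) → ℝ := fun v => (ball c s).indicator f (c + v) with hF
  have hFm : Measurable F := hfm.comp (measurable_const_add c)
  have hHint : ∫⁻ z, H z = ∫⁻ z in S, ENNReal.ofReal |f z - (ball c r).indicator (fun _ => 1) z| := by
    rw [hH, lintegral_indicator hSm]
    refine setLIntegral_congr_fun hSm fun z hz => ?_
    simp only [indicator_of_mem (hSs hz)]
  have hpt : ∀ v ∈ A, 1 ≤ ENNReal.ofReal |F v - F (l • v)| + (H (c + v) + H (c + l • v)) := by
    intro v hv
    have hv1 : ‖v‖ < r := mem_ball_zero_iff.1 hv.1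
    have hv2 : ρ < ‖v‖ := not_le.1 (mt mem_closedBall_zero_iff.2 hv.2)
    have hlv : ‖l • v‖ = l * ‖v‖ := by
      rw [norm_smul, Real.norm_of_nonneg (zero_le_one.trans hl)]
    have h1 : c + v ∈ S := by
      simp only [hS, Set.mem_sdiff, mem_closedBall, dist_self_add_left, not_le]
      exact ⟨by nlinarith, hv2⟩
    have h2 : c + l • v ∈ S := by
      simp only [hS, Set.mem_sdiff, mem_closedBall, dist_self_add_left, not_le, hlv]
      exact ⟨by nlinarith, by nlinarith⟩
    have h3 : c + v ∈ ball c r := by rwa [mem_ball, dist_self_add_left]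
    have h4 : c + l • v ∉ ball c r := by
      rw [mem_ball, dist_self_add_left, hlv, not_lt]
      nlinarith
    simp only [hH, hF, indicator_of_mem h1, indicator_of_mem h2, indicator_of_mem h3,
      indicator_of_notMem h4]
    rw [← ENNReal.ofReal_add (abs_nonneg _) (abs_nonneg _),
      ← ENNReal.ofReal_add (abs_nonneg _) (by positivity), ENNReal.one_le_ofReal]
    set p := (ball c s).indicator f (c + v)
    set q := (ball c s).indicator f (c + l • v)
    linarith [le_abs_self (p - q), neg_abs_le (p - 1), le_abs_self (q - 0)]
  calc volume A = ∫⁻ v in A, 1 := by rw [setLIntegral_one]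
    _ ≤ ∫⁻ v in A, (ENNReal.ofReal |F v - F (l • v)| + (H (c + v) + H (c + l • v))) :=
        setLIntegral_mono' hAm hpt
    _ ≤ (∫⁻ v in A, ENNReal.ofReal |F v - F (l • v)|) +
          ((∫⁻ v in A, H (c + v)) + ∫⁻ v in A, H (c + l • v)) := by
        have hm1 : Measurable fun v => H (c + v) := hHm.comp (measurable_const_add c)
        have hm2 : Measurable fun v : EuclideanSpace ℝ (Fin 2) => H (c + l • v) :=
          hm1.comp (measurable_const_smul l)
        have hm3 : Measurable fun v => H (c + v) + H (c + l • v) := hm1.add hm2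
        rw [lintegral_add_right _ hm3, lintegral_add_right _ hm2]
    _ ≤ _ := by
        rw [← hHint, two_mul]
        refine add_le_add (lintegral_annulus_abs_sub_le hρ hr hl hs hf hFm
          fun v hv => indicator_of_mem hv f) (add_le_add ?_ ?_)
        · refine (setLIntegral_le_lintegral _ _).trans_eq ?_
          exact lintegral_add_left_eq_self H c
        · refine (setLIntegral_le_lintegral _ _).trans ((lintegral_comp_smul_le hl
            (hHm.comp (measurable_const_add c))).trans_eq ?_)
          exact lintegral_add_left_eq_self H c

theorem le_Per_ball {m : Measure (EuclideanSpace ℝ (Fin 2))} {c : EuclideanSpace ℝ (Fin 2)}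
    {ρ r : ℝ} (hρ : 0 < ρ) (hr : ρ < r) (hr' : r ≤ 11 / 10 * ρ)
    (hm : m.restrict (ball c (3 / 2 * ρ) \ closedBall c ρ) =
      (2 : ℝ≥0∞) • volume.restrict (ball c (3 / 2 * ρ) \ closedBall c ρ))
    {F : Set (EuclideanSpace ℝ (Fin 2))} (hF : ∀ z ∈ ball c (3 / 2 * ρ), z ∈ F ↔ z ∈ ball c r) :
    ENNReal.ofReal (3 * Real.pi * ρ) ≤ Per m F (ball c (3 / 2 * ρ)) := by
  refine le_Per fun f hf hlim => ?_
  have hr0 : 0 < r := hρ.trans hr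
  have hs : 11 / 10 * r < 3 / 2 * ρ := by linarith
  set κ : ℝ := (11 / 10 * r) ^ 2 * (1 / ρ - 1 / r) with hκ
  have hκ0 : 0 < κ := mul_pos (by positivity) (sub_pos.2 (one_div_lt_one_div_of_lt hρ hr))
  set T : Set (EuclideanSpace ℝ (Fin 2)) := ball c (11 / 10 * r) \ closedBall c ρ with hT
  set S : Set (EuclideanSpace ℝ (Fin 2)) := closedBall c (11 / 10 * r) \ closedBall c ρ with hS
  have hm2 : ∀ B ⊆ ball c (3 / 2 * ρ) \ closedBall c ρ, MeasurableSet B →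
      ∀ g : EuclideanSpace ℝ (Fin 2) → ℝ≥0∞, 2 * ∫⁻ z in B, g z = ∫⁻ z in B, g z ∂m := by
    intro B hB hBm g
    have h := congrArg (Measure.restrict · B) hm
    simp only [Measure.restrict_smul, Measure.restrict_restrict hBm,
      inter_eq_self_of_subset_left hB] at h
    rw [h, lintegral_smul_measure, smul_eq_mul]
  have hK : closedBall c (11 / 10 * r) ⊆ ball c (3 / 2 * ρ) := closedBall_subset_ball hs
  have hbound : ∀ k, 2 * volume (ball (0 : EuclideanSpace ℝ (Fin 2)) r \ closedBall 0 ρ) ≤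
      ENNReal.ofReal κ * ∫⁻ z in ball c (3 / 2 * ρ), mSlope (f k) z ∂m +
        2 * ∫⁻ z in closedBall c (11 / 10 * r),
          ENNReal.ofReal |f k z - F.indicator (fun _ => 1) z| ∂m := by
    intro k
    calc _ ≤ 2 * (ENNReal.ofReal κ * (∫⁻ z in T, mSlope (f k) z) +
          2 * ∫⁻ z in S, ENNReal.ofReal |f k z - (ball c r).indicator (fun _ => 1) z|) :=
          mul_le_mul_right (volume_annulus_le hρ hr (by norm_num) hr' hs (hf k)) _
      _ = ENNReal.ofReal κ * ∫⁻ z in T, mSlope (f k) z ∂m +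
          2 * ∫⁻ z in S, ENNReal.ofReal |f k z - (ball c r).indicator (fun _ => 1) z| ∂m := by
          rw [← hm2 T (sdiff_subset_sdiff_left (ball_subset_closedBall.trans hK))
              (measurableSet_ball.diff measurableSet_closedBall),
            ← hm2 S (sdiff_subset_sdiff_left hK)
              (measurableSet_closedBall.diff measurableSet_closedBall)]
          ring
      _ ≤ _ := by
          refine add_le_add (mul_le_mul_right ?_ _) (mul_le_mul_right ?_ _)
          · exact lintegral_mono_set (sdiff_subset.trans (ball_subset_closedBall.trans hK))
          · refine (lintegral_mono_set sdiff_subset).trans_eq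
              (setLIntegral_congr_fun measurableSet_closedBall fun z hz => ?_)
            have h : (ball c r).indicator (fun _ => (1 : ℝ)) z = F.indicator (fun _ => 1) z := by
              by_cases hz' : z ∈ F
              · rw [indicator_of_mem hz', indicator_of_mem ((hF z (hK hz)).1 hz')]
              · rw [indicator_of_notMem hz', indicator_of_notMem (mt (hF z (hK hz)).2 hz')]
            simp only [h]
  have hε : Tendsto (fun k => 2 * ∫⁻ z in closedBall c (11 / 10 * r),
      ENNReal.ofReal |f k z - F.indicator (fun _ => 1) z| ∂m) atTop (𝓝 0) := by
    simpa using ENNReal.Tendsto.const_mul (a := 2) (hlim _ hK (isCompact_closedBall _ _))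
      (.inr ENNReal.ofNat_ne_top)
  refine (ENNReal.mul_le_mul_iff_right (ENNReal.ofReal_pos.2 hκ0).ne' ENNReal.ofReal_ne_top).1 ?_
  calc ENNReal.ofReal κ * ENNReal.ofReal (3 * Real.pi * ρ)
      ≤ 2 * volume (ball (0 : EuclideanSpace ℝ (Fin 2)) r \ closedBall 0 ρ) := by
        rw [volume_ball_diff_closedBall hρ.le hr.le, ← ENNReal.ofReal_mul hκ0.le,
          show (2 : ℝ≥0∞) = ENNReal.ofReal 2 by simp, ← ENNReal.ofReal_mul (by norm_num)]
        refine ENNReal.ofReal_le_ofReal ?_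
        have : κ * (3 * Real.pi * ρ) = Real.pi * (363 / 100 * r * (r - ρ)) := by
          rw [hκ]; field_simp; ring
        rw [this]
        nlinarith [mul_nonneg Real.pi_pos.le (mul_nonneg (sub_nonneg.2 hr.le)
          (show 0 ≤ 2 * ρ - 163 / 100 * r by linarith))]
    _ ≤ liminf (fun k => ENNReal.ofReal κ * ∫⁻ z in ball c (3 / 2 * ρ), mSlope (f k) z ∂m +
        2 * ∫⁻ z in closedBall c (11 / 10 * r),
          ENNReal.ofReal |f k z - F.indicator (fun _ => 1) z| ∂m) atTop :=
        le_liminf_of_le (by isBoundedDefault) (.of_forall hbound)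
    _ = liminf (fun k => ENNReal.ofReal κ *
          ∫⁻ z in ball c (3 / 2 * ρ), mSlope (f k) z ∂m) atTop :=
        ENNReal.liminf_add_of_right_tendsto_zero hε _
    _ = _ := ENNReal.liminf_const_mul_of_ne_top ENNReal.ofReal_ne_top

end Enlarged

/-! ### Failure of the deformation inequality near a ball -/

section Failure

theorem exists_lt_Per_union_ball {m : Measure (EuclideanSpace ℝ (Fin 2))}
    [IsLocallyFiniteMeasure m] {c : EuclideanSpace ℝ (Fin 2)} {ρ R C : ℝ} (hρ : 0 < ρ)
    (hρR : ρ < R) {E B : Set (EuclideanSpace ℝ (Fin 2))} (hB : IsOpen B)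
    (hcB : closedBall c (2 * ρ) ⊆ B) (hE : ∀ z ∈ closedBall c (2 * ρ), z ∈ E ↔ z ∈ ball c ρ)
    (hfin : Per m E B < ∞) (hm : ∀ S, m S ≤ 2 * volume S)
    (hm1 : ∀ S ⊆ closedBall c ρ, m S ≤ volume S)
    (hm2 : m.restrict (ball c (3 / 2 * ρ) \ closedBall c ρ) =
      (2 : ℝ≥0∞) • volume.restrict (ball c (3 / 2 * ρ) \ closedBall c ρ)) :
    ∃ r ∈ Ioo 0 R, ENNReal.ofReal C * m (ball c r \ E) / ENNReal.ofReal r + Per m E B <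
      Per m (E ∪ ball c r) B := by
  have hev : ∀ᶠ ε in 𝓝[>] (0 : ℝ), ε < 1 / 10 ∧ ρ * (1 + ε) < R ∧ 6 * |C| * ε < 1 := by
    refine nhdsWithin_le_nhds (((gt_mem_nhds (by norm_num)).and
      (Eventually.and ?_ ?_)))
    · exact (Continuous.tendsto' (by fun_prop) 0 ρ (by simp)).eventually_lt_const hρR
    · exact (Continuous.tendsto' (by fun_prop) 0 0 (by simp)).eventually_lt_const one_pos
  obtain ⟨ε, ⟨hε1, hεR, hεC⟩, hε⟩ := (hev.and self_mem_nhdsWithin).exists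
  have hε0 : 0 < ε := hε
  set r := ρ * (1 + ε) with hr
  have hρr : ρ < r := by rw [hr]; nlinarith
  have hr0 : 0 < r := hρ.trans hρr
  have hr' : r ≤ 11 / 10 * ρ := by rw [hr]; nlinarith
  refine ⟨r, ⟨hr0, hεR⟩, ?_⟩
  have hball : ball c (3 / 2 * ρ) ⊆ B :=
    (ball_subset_closedBall.trans (closedBall_subset_closedBall (by linarith))).trans hcB
  have hmass : ENNReal.ofReal C * m (ball c r \ E) / ENNReal.ofReal r <
      ENNReal.ofReal (Real.pi * ρ) := by
    have hsub : ball c r \ E ⊆ closedBall c r \ ball c ρ := fun z hz =>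
      ⟨ball_subset_closedBall hz.1, fun hz' => hz.2
        ((hE z (ball_subset_closedBall.trans (closedBall_subset_closedBall (by linarith)) hz')).2
          hz')⟩
    calc ENNReal.ofReal C * m (ball c r \ E) / ENNReal.ofReal r
        ≤ ENNReal.ofReal |C| * (2 * volume (closedBall c r \ ball c ρ)) / ENNReal.ofReal r := by
          gcongr
          · exact le_abs_self C
          · exact (measure_mono hsub).trans (hm _)
      _ = ENNReal.ofReal (|C| * (2 * (Real.pi * (r ^ 2 - ρ ^ 2))) / r) := by
          rw [volume_closedBall_diff_ball hρ.le hρr.le, show (2 : ℝ≥0∞) = ENNReal.ofReal 2 by simp,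
            ← ENNReal.ofReal_mul (by norm_num), ← ENNReal.ofReal_mul (abs_nonneg C),
            ← ENNReal.ofReal_div_of_pos hr0]
      _ < ENNReal.ofReal (Real.pi * ρ) := by
          refine (ENNReal.ofReal_lt_ofReal_iff (mul_pos Real.pi_pos hρ)).2 ?_
          rw [div_lt_iff₀ hr0]
          calc |C| * (2 * (Real.pi * (r ^ 2 - ρ ^ 2)))
              = Real.pi * ρ ^ 2 * (|C| * ε * (2 * (2 + ε))) := by rw [hr]; ring
            _ ≤ Real.pi * ρ ^ 2 * (|C| * ε * 6) := by gcongr; linarith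
            _ < Real.pi * ρ ^ 2 * 1 := by gcongr; linarith
            _ ≤ Real.pi * ρ * r := by nlinarith [mul_pos Real.pi_pos hρ]
  set U := B \ closedBall c (3 / 2 * ρ) with hU
  have hUo : IsOpen U := hB.sdiff isClosed_closedBall
  have hUB : Per m E U ≤ Per m E B := Per_mono sdiff_subset
  have hsplit : Per m E U + ENNReal.ofReal (3 * Real.pi * ρ) ≤ Per m (E ∪ ball c r) B := by
    refine le_trans (add_le_add (Per_le_of_inter_eq (F := E ∪ ball c r) hUo fun z hz => ?_)
      (le_Per_ball (F := E ∪ ball c r) hρ hρr hr' hm2 fun z hz => ?_))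
      (Per_add_le_of_disjoint hUo isOpen_ball sdiff_subset hball ?_)
    · refine ⟨fun h => .inl h, fun h => h.resolve_right fun h' => hz.2 ?_⟩
      exact ball_subset_closedBall.trans (closedBall_subset_closedBall (by linarith)) h'
    · refine ⟨fun h => h.elim (fun h => ?_) id, fun h => .inr h⟩
      exact ball_subset_ball hρr.le ((hE z (ball_subset_closedBall.trans
        (closedBall_subset_closedBall (by linarith)) hz)).1 h)
    · exact disjoint_left.2 fun z hz hz' => hz.2 (ball_subset_closedBall hz')
  calc ENNReal.ofReal C * m (ball c r \ E) / ENNReal.ofReal r + Per m E B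
      < ENNReal.ofReal (Real.pi * ρ) + Per m E B := ENNReal.add_lt_add_right hfin.ne hmass
    _ ≤ ENNReal.ofReal (Real.pi * ρ) + (Per m E U + ENNReal.ofReal (2 * Real.pi * ρ)) := by
        gcongr
        exact Per_le_Per_diff_closedBall_add hρ hB hcB hE hm1
    _ = Per m E U + ENNReal.ofReal (3 * Real.pi * ρ) := by
        rw [add_left_comm, ← ENNReal.ofReal_add (by positivity) (by positivity)]
        congr 2
        ring
    _ ≤ _ := hsplit

theorem restrict_withDensity_of_eqOn {α : Type*} [MeasurableSpace α] {μ : Measure α}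
    {w : α → ℝ≥0∞} {a : ℝ≥0∞} {A : Set α} (hA : MeasurableSet A) (hw : ∀ z ∈ A, w z = a) :
    (μ.withDensity w).restrict A = a • μ.restrict A := by
  rw [restrict_withDensity hA, withDensity_congr_ae (ae_restrict_of_forall_mem hA hw),
    withDensity_const]

end Failure

/-- **A PI space without the deformation property** (Remark 3.4): on `ℝ²` weighted by a
density equal to `1` on a union `E` of well-separated balls accumulating at the origin
and `2` elsewhere, `E` has finite perimeter but the deformation property fails at the
origin for `E`; in particular the space does not have the deformation property. -/
theorem example_PI_without_deformation_property
    (x_ : ℕ → EuclideanSpace ℝ (Fin 2)) (hx0 : ∀ n, x_ n ≠ 0)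
    (hxlim : Tendsto x_ atTop (𝓝 0))
    (r_ : ℕ → ℝ) (hr : ∀ n, 0 < r_ n) (hsum : Summable r_)
    (hdisj : Pairwise fun i j =>
      Disjoint (Metric.closedBall (x_ i) (2 * r_ i)) (Metric.closedBall (x_ j) (2 * r_ j)))
    (h0 : ∀ n, (0 : EuclideanSpace ℝ (Fin 2)) ∉ Metric.closedBall (x_ n) (2 * r_ n))
    (E : Set (EuclideanSpace ℝ (Fin 2))) (hE : E = ⋃ n, Metric.ball (x_ n) (r_ n))
    (m : Measure (EuclideanSpace ℝ (Fin 2)))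
    (hm : m = volume.withDensity fun z =>
      Set.indicator E (fun _ => (1 : ℝ≥0∞)) z + Set.indicator Eᶜ (fun _ => (2 : ℝ≥0∞)) z) :
    HasFinPer m E ∧
    (∀ R : ℝ, 0 < R → R ≤ 1 → ∀ C : ℝ, 0 ≤ C →
      ∃ y ∈ Metric.ball (0 : EuclideanSpace ℝ (Fin 2)) R, ∃ r ∈ Set.Ioo (0:ℝ) R,
        ENNReal.ofReal C * m (Metric.ball y r \ E) / ENNReal.ofReal r +
            Per m E (Metric.ball (0 : EuclideanSpace ℝ (Fin 2)) (2 * R)) <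
          Per m (E ∪ Metric.ball y r)
            (Metric.ball (0 : EuclideanSpace ℝ (Fin 2)) (2 * R))) ∧
    ¬ DeformationProperty m := by
  have hEo : IsOpen E := hE ▸ isOpen_iUnion fun n => isOpen_ball
  have hmemE : ∀ n, ∀ z ∈ closedBall (x_ n) (2 * r_ n), z ∈ E ↔ z ∈ ball (x_ n) (r_ n) := by
    intro n z hz
    refine ⟨fun h => ?_, fun h => hE ▸ mem_iUnion.2 ⟨n, h⟩⟩
    obtain ⟨k, hk⟩ := mem_iUnion.1 (hE ▸ h)
    by_cases hkn : k = n
    · exact hkn ▸ hk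
    · exact absurd hz (disjoint_left.1 (hdisj hkn) (ball_subset_closedBall.trans
        (closedBall_subset_closedBall (by linarith [hr k])) hk))
  have hmle : m ≤ (2 : ℝ≥0∞) • volume := by
    rw [hm, ← withDensity_const]
    refine withDensity_mono (.of_forall fun z => ?_)
    by_cases hz : z ∈ E <;> simp [hz]
  have hm2 : ∀ S, m S ≤ 2 * volume S := fun S => hmle S
  have : IsLocallyFiniteMeasure m := by
    refine ⟨fun z => ⟨ball z 1, ball_mem_nhds z one_pos, (hm2 _).trans_lt ?_⟩⟩
    exact ENNReal.mul_lt_top (by simp) measure_ball_lt_top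
  have hm1 : ∀ n, ∀ S ⊆ closedBall (x_ n) (r_ n), m S ≤ volume S := by
    intro n S hS
    have hball : m.restrict (ball (x_ n) (r_ n)) = volume.restrict (ball (x_ n) (r_ n)) := by
      rw [hm, restrict_withDensity_of_eqOn (a := 1) measurableSet_ball, one_smul]
      intro z hz
      have hzE : z ∈ E := hE ▸ mem_iUnion.2 ⟨n, hz⟩
      simp [hzE]
    have hsphere : m (sphere (x_ n) (r_ n)) = 0 := by
      refine le_antisymm ((hm2 _).trans_eq ?_) (zero_le)
      rw [Measure.addHaar_sphere, mul_zero]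
    calc m S ≤ m (S ∩ ball (x_ n) (r_ n) ∪ sphere (x_ n) (r_ n)) := by
          refine measure_mono fun z hz => ?_
          rcases (mem_closedBall.1 (hS hz)).lt_or_eq with h | h
          · exact .inl ⟨hz, h⟩
          · exact .inr h
      _ ≤ m (S ∩ ball (x_ n) (r_ n)) + 0 := hsphere ▸ measure_union_le _ _
      _ = volume (S ∩ ball (x_ n) (r_ n)) := by
          rw [add_zero, ← Measure.restrict_apply' measurableSet_ball, hball,
            Measure.restrict_apply' measurableSet_ball]
      _ ≤ volume S := measure_mono inter_subset_left
  have hmann : ∀ n, m.restrict (ball (x_ n) (3 / 2 * r_ n) \ closedBall (x_ n) (r_ n)) =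
      (2 : ℝ≥0∞) • volume.restrict (ball (x_ n) (3 / 2 * r_ n) \ closedBall (x_ n) (r_ n)) := by
    intro n
    rw [hm]
    refine restrict_withDensity_of_eqOn (measurableSet_ball.diff measurableSet_closedBall)
      fun z hz => ?_
    have hzE : z ∉ E := fun h => hz.2 (ball_subset_closedBall ((hmemE n z
      (ball_subset_closedBall.trans (closedBall_subset_closedBall (by linarith [hr n])) hz.1)).1 h))
    simp [hzE]
  have hfin : HasFinPer m E := by
    rw [hE]
    refine hasFinPer_iUnion_ball hr hsum (fun i j hij => ?_) hm1
    exact (hdisj hij).mono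
      (ball_subset_closedBall.trans (closedBall_subset_closedBall (by linarith [hr i])))
      (ball_subset_closedBall.trans (closedBall_subset_closedBall (by linarith [hr j])))
  have hfail : ∀ R : ℝ, 0 < R → R ≤ 1 → ∀ C : ℝ, 0 ≤ C →
      ∃ y ∈ ball (0 : EuclideanSpace ℝ (Fin 2)) R, ∃ r ∈ Ioo (0 : ℝ) R,
        ENNReal.ofReal C * m (ball y r \ E) / ENNReal.ofReal r +
            Per m E (ball (0 : EuclideanSpace ℝ (Fin 2)) (2 * R)) <
          Per m (E ∪ ball y r) (ball (0 : EuclideanSpace ℝ (Fin 2)) (2 * R)) := by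
    intro R hR _ C _
    obtain ⟨n, hn1, hn2⟩ := ((hxlim.eventually (ball_mem_nhds 0 hR)).and
      (hsum.tendsto_atTop_zero.eventually_lt_const (half_pos hR))).exists
    refine ⟨x_ n, hn1, exists_lt_Per_union_ball (hr n) (by linarith) isOpen_ball ?_ (hmemE n)
      ((Per_mono (subset_univ _)).trans_lt hfin) hm2 (hm1 n) (hmann n)⟩
    refine closedBall_subset_ball' ?_
    linarith [mem_ball.1 hn1]
  refine ⟨hfin, hfail, fun hdef => ?_⟩
  obtain ⟨R, hR, hR1, C, hC, hdef⟩ := hdef E hEo.measurableSet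
    (fun z => ⟨1, one_pos, (Per_mono (subset_univ _)).trans_lt hfin⟩) 0
  obtain ⟨y, hy, r, hrR, hlt⟩ := hfail R hR hR1 C hC
  exact hlt.not_ge (hdef y hy r hrR).2

end
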